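/- arXiv:math-ph/0007039 — 2 statements merged into one kernel-verified Lean document; each statement's English description precedes it below -/
import Mathlib

section
/- Let H₀ ≥ I be self-adjoint with e^{−β₀ H₀} trace class for some 0 < β₀ < 1, and let X be a q₀-bounded symmetric form with relative bound a < 1 − β₀. Then for the KLMN operator H_X = H₀ + X, the operator e^{−β H_X} is trace class for all β > β₀/(1 − a). -/
open scoped InnerProductSpace
open Complex

variable {H : Type} [NormedAddCommGroup H] [InnerProductSpace ℂ H] [CompleteSpace H]

/-- A (positive) operator is trace class if the sums `∑ ⟪v, T v⟫` over finite
orthonormal families are uniformly bounded. -/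
def IsTraceClassPos (T : H →L[ℂ] H) : Prop :=
  ∃ C : ℝ, ∀ s : Finset H, (∀ v ∈ s, ‖v‖ = 1) →
    (∀ v ∈ s, ∀ w ∈ s, v ≠ w → (⟪v, w⟫_ℂ : ℂ) = 0) →
    ∑ v ∈ s, ((⟪v, T v⟫_ℂ : ℂ)).re ≤ C

/-- `E` is the heat semigroup `t ↦ e^{-tB}` of the self-adjoint operator `B`:
a strongly continuous semigroup of positive self-adjoint operators whose generator
is `-B`. -/
structure IsHeatSemigroup (E : ℝ → H →L[ℂ] H) (B : H →ₗ.[ℂ] H) : Prop where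
  zero : E 0 = 1
  semigroup : ∀ s t : ℝ, 0 ≤ s → 0 ≤ t → E (s + t) = (E s).comp (E t)
  selfadj : ∀ t : ℝ, 0 ≤ t → IsSelfAdjoint (E t)
  pos : ∀ t : ℝ, 0 ≤ t → (E t).IsPositive
  strong_cont : ∀ x : H, ContinuousOn (fun t => E t x) (Set.Ici (0 : ℝ))
  generator : ∀ ψ : B.domain, HasDerivWithinAt (fun t => E t (ψ : H)) (-(B ψ))
    (Set.Ici (0 : ℝ)) 0


section Auxiliary

open Filter Topology

lemma HasDerivWithinAt.tendsto_dyadic {G : Type*} [NormedAddCommGroup G] [InnerProductSpace ℂ G]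
    {f : ℝ → G} {f' : G}
    (hf : HasDerivWithinAt f f' (Set.Ici 0) 0) {τ : ℝ} (hτ : 0 < τ) :
    Tendsto (fun n : ℕ => (2 ^ n : ℝ) • (f (τ / 2 ^ n) - f 0)) atTop (𝓝 (τ • f')) := by
  have h1 := hasDerivWithinAt_iff_tendsto_slope.1 hf
  have h2 : Tendsto (fun n : ℕ => τ / 2 ^ n) atTop (𝓝[Set.Ici 0 \ {0}] 0) := by
    refine tendsto_nhdsWithin_iff.2 ⟨?_, Eventually.of_forall fun n => ?_⟩
    · exact tendsto_const_nhds.div_atTop (tendsto_pow_atTop_atTop_of_one_lt one_lt_two)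
    · have : 0 < τ / 2 ^ n := by positivity
      exact ⟨this.le, this.ne'⟩
  refine ((h1.comp h2).const_smul τ).congr fun n => ?_
  simp only [Function.comp, slope_def_module, sub_zero, smul_smul]
  congr 1
  field_simp

lemma exp_le_of_sq_le_of_tendsto {x : ℕ → ℝ} {q : ℝ}
    (hsq : ∀ n, x (n + 1) ^ 2 ≤ x n)
    (hx : Tendsto (fun n : ℕ => (2 : ℝ) ^ n * (x n - 1)) atTop (𝓝 q)) :
    Real.exp q ≤ x 0 := by
  have hpow : ∀ n, x n ^ 2 ^ n ≤ x 0 := by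
    intro n
    induction n with
    | zero => simp
    | succ n ih =>
      calc x (n + 1) ^ 2 ^ (n + 1) = (x (n + 1) ^ 2) ^ 2 ^ n := by rw [← pow_mul, pow_succ']
        _ ≤ x n ^ 2 ^ n := pow_le_pow_left₀ (sq_nonneg _) (hsq n) _
        _ ≤ x 0 := ih
  have key : ∀ r < q, Real.exp r ≤ x 0 := by
    intro r hr
    have hlim : Tendsto (fun n : ℕ => (1 + r / ((2 ^ n : ℕ) : ℝ)) ^ 2 ^ n) atTop
        (𝓝 (Real.exp r)) :=
      (Real.tendsto_one_add_div_pow_exp r).comp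
        (tendsto_pow_atTop_atTop_of_one_lt (r := 2) one_lt_two)
    have hz : Tendsto (fun n : ℕ => r / ((2 ^ n : ℕ) : ℝ)) atTop (𝓝 0) := by
      push_cast
      exact tendsto_const_nhds.div_atTop (tendsto_pow_atTop_atTop_of_one_lt one_lt_two)
    refine le_of_tendsto hlim ?_
    filter_upwards [hx.eventually (lt_mem_nhds hr), hz.eventually (lt_mem_nhds (neg_one_lt_zero))]
      with n hn hn'
    refine (pow_le_pow_left₀ (by linarith) ?_ _).trans (hpow n)
    have h2 : (0 : ℝ) < 2 ^ n := by positivity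
    have : r / ((2 ^ n : ℕ) : ℝ) ≤ x n - 1 := by
      push_cast
      rw [div_le_iff₀ h2]
      linarith
    linarith
  refine le_of_tendsto ((Real.continuous_exp.tendsto q).mono_left
    (nhdsWithin_le_nhds (s := Set.Iio q))) ?_
  filter_upwards [self_mem_nhdsWithin] with r hr using key r hr

lemma IsSelfAdjoint.inner_mul_self {S : H →L[ℂ] H} (hS : IsSelfAdjoint S) (w : H) :
    (⟪w, S (S w)⟫_ℂ : ℂ).re = ‖S w‖ ^ 2 := by
  rw [← ContinuousLinearMap.adjoint_inner_left, hS.adjoint_eq]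
  exact inner_self_eq_norm_sq (𝕜 := ℂ) (S w)

lemma mul_exp_le_re_inner_of_dyadic {S : ℕ → H →L[ℂ] H} (hsa : ∀ n, IsSelfAdjoint (S n))
    (hroot : ∀ n, S n = (S (n + 1)).comp (S (n + 1))) {w y : H} (hw : w ≠ 0)
    (hlim : Tendsto (fun n : ℕ => (2 ^ n : ℝ) • (S n w - w)) atTop (𝓝 y)) :
    ‖w‖ ^ 2 * Real.exp ((⟪w, y⟫_ℂ : ℂ).re / ‖w‖ ^ 2) ≤ (⟪w, S 0 w⟫_ℂ : ℂ).re := by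
  have hn : 0 < ‖w‖ := norm_pos_iff.2 hw
  have hre : ∀ n, (⟪w, S n w⟫_ℂ : ℂ).re = ‖S (n + 1) w‖ ^ 2 := fun n => by
    rw [hroot n]
    exact (hsa _).inner_mul_self w
  have := exp_le_of_sq_le_of_tendsto (x := fun n => (⟪w, S n w⟫_ℂ : ℂ).re / ‖w‖ ^ 2)
    (q := (⟪w, y⟫_ℂ : ℂ).re / ‖w‖ ^ 2)
    (fun n => by
      rw [hre n, div_pow, div_le_div_iff₀ (by positivity) (by positivity)]
      have h1 : |(⟪w, S (n + 1) w⟫_ℂ : ℂ).re| ≤ ‖w‖ * ‖S (n + 1) w‖ :=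
        (Complex.abs_re_le_norm _).trans (norm_inner_le_norm _ _)
      have h2 := pow_le_pow_left₀ (abs_nonneg _) h1 2
      rw [sq_abs, mul_pow] at h2
      nlinarith [sq_nonneg ‖w‖])
    (by
      have h1 : Tendsto (fun n : ℕ => (⟪w, (2 ^ n : ℝ) • (S n w - w)⟫_ℂ : ℂ).re / ‖w‖ ^ 2) atTop
          (𝓝 ((⟪w, y⟫_ℂ : ℂ).re / ‖w‖ ^ 2)) :=
        ((Complex.continuous_re.tendsto _).comp (tendsto_const_nhds.inner hlim)).div_const _
      refine h1.congr fun n => ?_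
      have h2 : (⟪w, w⟫_ℂ : ℂ).re = ‖w‖ ^ 2 := inner_self_eq_norm_sq (𝕜 := ℂ) w
      have h3 : (⟪w, (2 ^ n : ℝ) • (S n w - w)⟫_ℂ : ℂ).re
          = 2 ^ n * ((⟪w, S n w⟫_ℂ : ℂ).re - ‖w‖ ^ 2) := by
        rw [← h2, inner_smul_right_eq_smul, Complex.smul_re, inner_sub_right, Complex.sub_re,
          smul_eq_mul]
      rw [h3]
      field_simp)
  rwa [le_div_iff₀ (by positivity), mul_comm] at this

lemma LinearPMap.exists_apply_eq_of_isSelfAdjoint {A : H →ₗ.[ℂ] H} (hA : IsSelfAdjoint A)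
    (hge : ∀ ψ : A.domain, ‖(ψ : H)‖ ≤ ‖A ψ‖) (φ : H) : ∃ ψ : A.domain, A ψ = φ := by
  have hcl : _root_.IsClosed (LinearMap.range A.toFun : Set H) := by
    refine isClosed_of_closure_subset fun y hy => ?_
    obtain ⟨u, hu, hlim⟩ := mem_closure_iff_seq_limit.1 hy
    choose v hv using hu
    have hc : CauchySeq fun n => (v n : H) := by
      rw [Metric.cauchySeq_iff]
      intro ε hε
      obtain ⟨N, hN⟩ := Metric.cauchySeq_iff.1 hlim.cauchySeq ε hε
      refine ⟨N, fun m hm n hn => lt_of_le_of_lt ?_ (hN m hm n hn)⟩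
      rw [dist_eq_norm, dist_eq_norm, ← hv m, ← hv n]
      change _ ≤ ‖A (v m) - A (v n)‖
      rw [← A.map_sub]
      exact hge (v m - v n)
    obtain ⟨x, hx⟩ := cauchySeq_tendsto_of_complete hc
    have hmem : (x, y) ∈ A.graph := by
      refine _root_.IsClosed.mem_of_tendsto (f := fun n => ((v n : H), u n)) hA.isClosed
        (hx.prodMk_nhds hlim) (Eventually.of_forall fun n => ?_)
      exact A.mem_graph_iff.2 ⟨v n, rfl, hv n⟩
    obtain ⟨z, -, hz⟩ := A.mem_graph_iff.1 hmem
    exact ⟨z, hz⟩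
  have : CompleteSpace (LinearMap.range A.toFun) := hcl.completeSpace_coe
  have htop : LinearMap.range A.toFun = ⊤ := by
    rw [← Submodule.orthogonal_eq_bot_iff, Submodule.eq_bot_iff]
    intro z hz
    have h0 : ∀ x : A.domain, (⟪(0 : H), x⟫_ℂ : ℂ) = ⟪z, A x⟫_ℂ := fun x => by
      rw [inner_zero_left]
      exact ((Submodule.mem_orthogonal' _ _).1 hz _ ⟨x, rfl⟩).symm
    have hzd : z ∈ A.adjoint.domain := A.mem_adjoint_domain_of_exists z ⟨0, h0⟩
    have hz0 := LinearPMap.adjoint_apply_eq hA.dense_domain ⟨z, hzd⟩ h0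
    have hle : ∀ B : H →ₗ.[ℂ] H, B = A → ∀ h : z ∈ B.domain, ‖z‖ ≤ ‖B ⟨z, h⟩‖ := by
      rintro B rfl h
      exact hge ⟨z, h⟩
    have := hle _ (LinearPMap.isSelfAdjoint_def.1 hA) hzd
    rw [hz0, norm_zero] at this
    exact norm_le_zero_iff.1 this
  have : φ ∈ LinearMap.range A.toFun := htop ▸ Submodule.mem_top
  exact this

/-- A weak solution of `B w = y` is a solution. -/
lemma LinearPMap.exists_apply_eq_of_weak {B : H →ₗ.[ℂ] H} (hB : IsSelfAdjoint B) {w y : H}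
    (h : ∀ x : B.domain, (⟪y, x⟫_ℂ : ℂ) = ⟪w, B x⟫_ℂ) :
    ∃ ψ : B.domain, (ψ : H) = w ∧ B ψ = y := by
  have hd : w ∈ B.adjoint.domain := B.mem_adjoint_domain_of_exists w ⟨y, h⟩
  have hy := LinearPMap.adjoint_apply_eq hB.dense_domain ⟨w, hd⟩ h
  have key : ∀ C : H →ₗ.[ℂ] H, B = C → ∀ hC : w ∈ C.domain, C ⟨w, hC⟩ = y →
      ∃ ψ : B.domain, (ψ : H) = w ∧ B ψ = y := by
    rintro C rfl hC hCy
    exact ⟨⟨w, hC⟩, rfl, hCy⟩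
  exact key _ (LinearPMap.isSelfAdjoint_def.1 hB).symm hd hy

lemma mul_exp_neg_le_re_inner
    {A : H →ₗ.[ℂ] H} (hA : IsSelfAdjoint A) (hge : ∀ ψ : A.domain, ‖(ψ : H)‖ ≤ ‖A ψ‖)
    {τ : ℝ} (hτ : 0 < τ) {E : ℝ → H →L[ℂ] H}
    (hE : ∀ ψ : A.domain, ∀ h : (A ψ : H) ∈ A.domain,
      HasDerivWithinAt (fun t => E t (ψ : H)) (-(A ⟨A ψ, h⟩)) (Set.Ici (0 : ℝ)) 0)
    (hsg : ∀ s t : ℝ, 0 ≤ s → 0 ≤ t → E (s + t) = (E s).comp (E t))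
    (hE0 : E 0 = 1) (hsa : ∀ t : ℝ, 0 ≤ t → IsSelfAdjoint (E t))
    (ψ : A.domain) (hψ : (ψ : H) ≠ 0) :
    ‖(ψ : H)‖ ^ 2 * Real.exp (-(τ * ‖A ψ‖ ^ 2) / ‖(ψ : H)‖ ^ 2)
      ≤ (⟪(ψ : H), E τ ψ⟫_ℂ : ℂ).re := by
  have hcore : ∀ ψ : A.domain, A ψ ∈ A.domain → (ψ : H) ≠ 0 →
      ‖(ψ : H)‖ ^ 2 * Real.exp (-(τ * ‖A ψ‖ ^ 2) / ‖(ψ : H)‖ ^ 2)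
        ≤ (⟪(ψ : H), E τ ψ⟫_ℂ : ℂ).re := by
    intro ψ hd hψ
    have hlim := (hE ψ hd).tendsto_dyadic hτ
    simp only [hE0, one_apply_eq_self] at hlim
    have := mul_exp_le_re_inner_of_dyadic (S := fun n => E (τ / 2 ^ n))
      (fun n => hsa _ (by positivity))
      (fun n => by
        rw [← hsg _ _ (by positivity) (by positivity), pow_succ]
        congr 1
        field_simp
        norm_num) hψ hlim
    have hadj : (⟪(ψ : H), A ⟨A ψ, hd⟩⟫_ℂ : ℂ) = ⟪A ψ, A ψ⟫_ℂ := by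
      have hf := LinearPMap.adjoint_isFormalAdjoint hA.dense_domain
      rw [LinearPMap.isSelfAdjoint_def.1 hA] at hf
      exact (hf ψ ⟨A ψ, hd⟩).symm
    have hval : (⟪(ψ : H), τ • -(A ⟨A ψ, hd⟩)⟫_ℂ : ℂ).re = -(τ * ‖A ψ‖ ^ 2) := by
      rw [inner_smul_right_eq_smul, inner_neg_right, hadj, Complex.smul_re, Complex.neg_re,
        smul_eq_mul, mul_neg]
      congr 2
      exact inner_self_eq_norm_sq (𝕜 := ℂ) (A ψ)
    rw [hval] at this
    simpa using this
  obtain ⟨u, hu, hlim⟩ := mem_closure_iff_seq_limit.1 (hA.dense_domain (A ψ))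
  choose v hv using fun n => LinearPMap.exists_apply_eq_of_isSelfAdjoint hA hge (u n)
  have hAv : Tendsto (fun n => A (v n)) atTop (𝓝 (A ψ)) := by simpa only [hv] using hlim
  have hvl : Tendsto (fun n => (v n : H)) atTop (𝓝 (ψ : H)) := by
    rw [tendsto_iff_norm_sub_tendsto_zero] at hAv ⊢
    refine squeeze_zero (fun _ => norm_nonneg _) (fun n => ?_) hAv
    rw [← A.map_sub]
    exact hge (v n - ψ)
  have h1 : Tendsto (fun n => ‖(v n : H)‖ ^ 2) atTop (𝓝 (‖(ψ : H)‖ ^ 2)) := hvl.norm.pow 2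
  have h2 : Tendsto (fun n => -(τ * ‖A (v n)‖ ^ 2) / ‖(v n : H)‖ ^ 2) atTop
      (𝓝 (-(τ * ‖A ψ‖ ^ 2) / ‖(ψ : H)‖ ^ 2)) :=
    ((hAv.norm.pow 2).const_mul τ).neg.div h1 (pow_ne_zero 2 (norm_ne_zero_iff.2 hψ))
  have h3 : Tendsto (fun n => (⟪(v n : H), E τ (v n)⟫_ℂ : ℂ).re) atTop
      (𝓝 (⟪(ψ : H), E τ ψ⟫_ℂ : ℂ).re) :=
    (Complex.continuous_re.tendsto _).comp (hvl.inner (((E τ).continuous.tendsto _).comp hvl))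
  refine le_of_tendsto_of_tendsto (h1.mul ((Real.continuous_exp.tendsto _).comp h2)) h3 ?_
  filter_upwards [hvl.eventually_ne hψ] with n hn
  exact hcore (v n) (by rw [hv]; exact hu n) hn

lemma IsTraceClassPos.exists_sum_le {G : Type} [NormedAddCommGroup G] [InnerProductSpace ℂ G]
    {K : G →L[ℂ] G} (hK : IsTraceClassPos K) :
    ∃ C : ℝ, ∀ (n : ℕ) (e : Fin n → G), Orthonormal ℂ e →
      ∑ i, (⟪e i, K (e i)⟫_ℂ : ℂ).re ≤ C := by
  obtain ⟨C, hC⟩ := hK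
  refine ⟨C, fun n e he => ?_⟩
  have hinj : Function.Injective e := he.linearIndependent.injective
  have := hC (Finset.univ.map ⟨e, hinj⟩)
    (by
      intro v hv
      obtain ⟨i, -, rfl⟩ := Finset.mem_map.1 hv
      exact he.1 i)
    (by
      intro v hv w hw hvw
      obtain ⟨i, -, rfl⟩ := Finset.mem_map.1 hv
      obtain ⟨j, -, rfl⟩ := Finset.mem_map.1 hw
      exact he.2 fun h => hvw (by rw [h]))
  simpa [Finset.sum_map] using this

lemma IsTraceClassPos.finiteDimensional {G : Type} [NormedAddCommGroup G] [InnerProductSpace ℂ G]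
    {K : G →L[ℂ] G} (hK : IsTraceClassPos K)
    {W : Submodule ℂ G} {δ : ℝ} (hδ : 0 < δ)
    (hW : ∀ w ∈ W, ‖w‖ = 1 → δ ≤ (⟪w, K w⟫_ℂ : ℂ).re) : FiniteDimensional ℂ W := by
  obtain ⟨C, hC⟩ := hK.exists_sum_le
  obtain ⟨N, hN⟩ := exists_nat_ge (C / δ)
  have hrank : Module.rank ℂ W ≤ N := by
    refine rank_le fun s hs => ?_
    let V : Submodule ℂ W := Submodule.span ℂ (s : Set W)
    have hVfd : FiniteDimensional ℂ V := FiniteDimensional.span_finset ℂ s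
    have hcard : Module.finrank ℂ V = s.card := finrank_span_finset_eq_card hs
    let e := stdOrthonormalBasis ℂ V
    have he : Orthonormal ℂ fun i => ((e i : W) : G) :=
      (e.orthonormal.comp_linearIsometry V.subtypeₗᵢ).comp_linearIsometry W.subtypeₗᵢ
    have h1 := hC _ _ he
    have h2 : ∑ _i : Fin (Module.finrank ℂ V), δ ≤ C :=
      (Finset.sum_le_sum fun i _ => hW _ (e i : W).2 (he.1 i)).trans h1
    rw [Finset.sum_const, Finset.card_univ, Fintype.card_fin, hcard, nsmul_eq_mul,
      ← le_div_iff₀ hδ] at h2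
    exact_mod_cast h2.trans hN
  exact Module.rank_lt_aleph0_iff.1 (hrank.trans_lt (Cardinal.natCast_lt_aleph0))

lemma cfc_rpow_pow {S : H →L[ℂ] H} (hS : 0 ≤ S) (N : ℕ) (hN : N ≠ 0) :
    cfc (fun x : ℝ => x ^ ((N : ℝ)⁻¹)) (S ^ N) = S := by
  have hsa : IsSelfAdjoint S := hS.isSelfAdjoint
  have hcont : Continuous fun x : ℝ => x ^ ((N : ℝ)⁻¹) :=
    Real.continuous_rpow_const (by positivity)
  rw [← cfc_comp_pow (fun x : ℝ => x ^ ((N : ℝ)⁻¹)) N S hcont.continuousOn hsa]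
  conv_rhs => rw [← cfc_id' ℝ S]
  refine cfc_congr fun x hx => ?_
  exact Real.pow_rpow_inv_natCast (spectrum_nonneg_of_nonneg hS hx) hN

/-- Cut off below `ε`, the dyadic roots of a positive operator have the logarithm as derivative. -/
lemma tendsto_dyadic_cfc (T : H →L[ℂ] H) {ε : ℝ} (hε : 0 < ε) :
    Tendsto (fun n : ℕ => (2 ^ n : ℝ) •
        (cfc (fun x : ℝ => x ^ (((2 ^ n : ℕ) : ℝ)⁻¹)) T * cfc (fun x : ℝ => max (x - ε) 0) T
          - cfc (fun x : ℝ => max (x - ε) 0) T)) atTop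
      (𝓝 (cfc (fun x : ℝ => Real.log (max x ε) * max (x - ε) 0) T)) := by
  have hg : Continuous fun x : ℝ => Real.log (max x ε) :=
    (continuous_id.max continuous_const).log fun x => (lt_max_of_lt_right hε).ne'
  have hf : Continuous fun x : ℝ => max (x - ε) 0 := by fun_prop
  have hr : ∀ n : ℕ, Continuous fun x : ℝ => x ^ (((2 ^ n : ℕ) : ℝ)⁻¹) := fun n =>
    Real.continuous_rpow_const (by positivity)
  have hsp : IsCompact (spectrum ℝ T) := spectrum.isCompact T
  obtain ⟨Λ, hΛ⟩ := hsp.exists_bound_of_continuousOn hg.continuousOn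
  obtain ⟨M, hM⟩ := hsp.exists_bound_of_continuousOn hf.continuousOn
  have hz : Tendsto (fun n : ℕ => |Λ| / 2 ^ n) atTop (𝓝 0) :=
    tendsto_const_nhds.div_atTop (tendsto_pow_atTop_atTop_of_one_lt one_lt_two)
  rw [tendsto_iff_norm_sub_tendsto_zero]
  have hz' : Tendsto (fun n : ℕ => |Λ| / 2 ^ n * (|Λ| * |M|)) atTop (𝓝 0) := by
    simpa using hz.mul_const (|Λ| * |M|)
  refine squeeze_zero' (Eventually.of_forall fun _ => norm_nonneg _) ?_ hz'
  filter_upwards [hz.eventually (gt_mem_nhds one_pos)] with n hn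
  have hp : (0 : ℝ) < 2 ^ n := by positivity
  have hrf : Continuous fun x : ℝ => x ^ (((2 ^ n : ℕ) : ℝ)⁻¹) * max (x - ε) 0 := (hr n).mul hf
  have hd : Continuous fun x : ℝ => x ^ (((2 ^ n : ℕ) : ℝ)⁻¹) * max (x - ε) 0 - max (x - ε) 0 :=
    hrf.sub hf
  have hsd : Continuous fun x : ℝ =>
      2 ^ n * (x ^ (((2 ^ n : ℕ) : ℝ)⁻¹) * max (x - ε) 0 - max (x - ε) 0) := hd.const_mul _
  have hgf : Continuous fun x : ℝ => Real.log (max x ε) * max (x - ε) 0 := hg.mul hf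
  rw [← cfc_mul _ _ T (hr n).continuousOn hf.continuousOn,
    ← cfc_sub _ _ T hrf.continuousOn hf.continuousOn, ← cfc_const_mul _ _ T hd.continuousOn,
    ← cfc_sub _ _ T hsd.continuousOn hgf.continuousOn]
  refine norm_cfc_le (by positivity) fun x hx => ?_
  rcases le_or_gt x ε with hxε | hxε
  · rw [max_eq_right (sub_nonpos.2 hxε)]
    simp only [mul_zero, sub_zero, norm_zero]
    positivity
  · have hx0 : 0 < x := hε.trans hxε
    have hgx := hΛ x hx
    have hfx := hM x hx
    rw [max_eq_left hxε.le] at hgx ⊢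
    set y := Real.log x / 2 ^ n with hy
    have hlog : Real.log x = 2 ^ n * y := by rw [hy]; field_simp
    have hxr : x ^ (((2 ^ n : ℕ) : ℝ)⁻¹) = Real.exp y := by
      rw [Real.rpow_def_of_pos hx0, hy, div_eq_mul_inv]
      push_cast
      rfl
    have hyle : |y| ≤ |Λ| / 2 ^ n := by
      rw [hy, abs_div, abs_of_pos hp]
      exact div_le_div_of_nonneg_right (hgx.trans (le_abs_self _)) hp.le
    have h1 := Real.abs_exp_sub_one_sub_id_le (hyle.trans hn.le)
    rw [hxr, hlog]
    have h2 : (2 : ℝ) ^ n * (Real.exp y * max (x - ε) 0 - max (x - ε) 0)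
        - 2 ^ n * y * max (x - ε) 0 = 2 ^ n * (Real.exp y - 1 - y) * max (x - ε) 0 := by ring
    rw [h2, norm_mul, norm_mul, Real.norm_of_nonneg hp.le, Real.norm_eq_abs (Real.exp y - 1 - y)]
    calc 2 ^ n * |Real.exp y - 1 - y| * ‖max (x - ε) 0‖
        ≤ 2 ^ n * (|Λ| / 2 ^ n) ^ 2 * |M| := by
          gcongr
          · exact h1.trans (by rw [← sq_abs]; gcongr)
          · exact hfx.trans (le_abs_self _)
      _ = |Λ| / 2 ^ n * (|Λ| * |M|) := by field_simp

lemma re_inner_nonneg_of_nonneg {G : Type*} [NormedAddCommGroup G] [InnerProductSpace ℂ G]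
    {T : G →L[ℂ] G} (hT : 0 ≤ T) (x : G) :
    0 ≤ (⟪x, T x⟫_ℂ : ℂ).re :=
  ((ContinuousLinearMap.nonneg_iff_isPositive T).1 hT).re_inner_nonneg_right x

lemma log_mul_sq_norm_le_re_inner_cfc {T : H →L[ℂ] H} (hT : 0 ≤ T) {ε : ℝ} (hε : 0 < ε)
    (v : H) :
    Real.log ε * ‖cfc (fun x : ℝ => max (x - ε) 0) T v‖ ^ 2 ≤
      (⟪cfc (fun x : ℝ => max (x - ε) 0) T v,
        cfc (fun x : ℝ => Real.log (max x ε) * max (x - ε) 0) T v⟫_ℂ : ℂ).re := by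
  have hsa : IsSelfAdjoint T := hT.isSelfAdjoint
  have hg : Continuous fun x : ℝ => Real.log (max x ε) :=
    (continuous_id.max continuous_const).log fun x => (lt_max_of_lt_right hε).ne'
  have hf : Continuous fun x : ℝ => max (x - ε) 0 := by fun_prop
  set F := cfc (fun x : ℝ => max (x - ε) 0) T with hF
  set L := cfc (fun x : ℝ => Real.log (max x ε) * max (x - ε) 0) T with hL
  have hFsa : IsSelfAdjoint F := cfc_predicate _ _
  have hnonneg : 0 ≤ F * L - Real.log ε • (F * F) := by
    have hgf : Continuous fun x : ℝ => Real.log (max x ε) * max (x - ε) 0 := hg.mul hf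
    have hfgf : Continuous fun x : ℝ => max (x - ε) 0 * (Real.log (max x ε) * max (x - ε) 0) :=
      hf.mul hgf
    have hff : Continuous fun x : ℝ => max (x - ε) 0 * max (x - ε) 0 := hf.mul hf
    have hlff : Continuous fun x : ℝ => Real.log ε * (max (x - ε) 0 * max (x - ε) 0) :=
      hff.const_mul _
    rw [hF, hL, ← cfc_mul _ _ T hf.continuousOn hgf.continuousOn,
      ← cfc_mul _ _ T hf.continuousOn hf.continuousOn, ← cfc_const_mul _ _ T hff.continuousOn,
      ← cfc_sub _ _ T hfgf.continuousOn hlff.continuousOn]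
    refine cfc_nonneg fun x _ => ?_
    have h1 : Real.log ε ≤ Real.log (max x ε) := Real.log_le_log hε (le_max_right _ _)
    nlinarith [mul_nonneg (sub_nonneg.2 h1) (mul_self_nonneg (max (x - ε) 0))]
  have := re_inner_nonneg_of_nonneg hnonneg v
  have h2 : (⟪v, F (L v)⟫_ℂ : ℂ) = ⟪F v, L v⟫_ℂ := by
    rw [← ContinuousLinearMap.adjoint_inner_left, hFsa.adjoint_eq]
  have h3 := hFsa.inner_mul_self v
  rw [sub_apply, smul_apply, inner_sub_right, inner_smul_right_eq_smul, Complex.sub_re,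
    Complex.smul_re, smul_eq_mul] at this
  change 0 ≤ (⟪v, F (L v)⟫_ℂ : ℂ).re - _ * (⟪v, F (F v)⟫_ℂ : ℂ).re at this
  rw [h2, h3] at this
  linarith

lemma apply_eq_smul_of_apply_apply_eq {G : Type*} [NormedAddCommGroup G] [InnerProductSpace ℂ G]
    {S : G →L[ℂ] G} (hS : 0 ≤ S) {c : ℝ} (hc : 0 < c) {u : G}
    (hu : S (S u) = (c ^ 2 : ℝ) • u) : S u = c • u := by
  set z := S u - c • u with hz
  have h1 : S z = -(c • z) := by
    rw [hz, map_sub, hu, S.map_smul_of_tower]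
    module
  have h2 := re_inner_nonneg_of_nonneg hS z
  rw [h1, inner_neg_right, inner_smul_right_eq_smul, Complex.neg_re, Complex.smul_re, smul_eq_mul]
    at h2
  have h3 : (⟪z, z⟫_ℂ : ℂ).re = ‖z‖ ^ 2 := inner_self_eq_norm_sq (𝕜 := ℂ) z
  rw [h3] at h2
  have h4 : ‖z‖ ^ 2 ≤ 0 := by nlinarith [sq_nonneg ‖z‖]
  have h5 : z = 0 := by
    rw [← norm_eq_zero]
    exact pow_eq_zero_iff two_ne_zero |>.1 (le_antisymm h4 (sq_nonneg _))
  exact sub_eq_zero.1 h5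

lemma tendsto_dyadic_eigenvector {G : Type*} [NormedAddCommGroup G] [InnerProductSpace ℂ G]
    {S : ℕ → G →L[ℂ] G} (hS : ∀ n, 0 ≤ S n)
    (hroot : ∀ n, S n = (S (n + 1)).comp (S (n + 1))) {μ : ℝ} (hμ : 0 < μ) {u : G}
    (hu : S 0 u = μ • u) :
    Tendsto (fun n : ℕ => (2 ^ n : ℝ) • (S n u - u)) atTop (𝓝 (Real.log μ • u)) := by
  have hSn : ∀ n, S n u = Real.exp (1 / 2 ^ n * Real.log μ) • u := by
    intro n
    induction n with
    | zero => simpa [Real.exp_log hμ] using hu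
    | succ n ih =>
      refine apply_eq_smul_of_apply_apply_eq (hS _) (Real.exp_pos _) ?_
      have : S n u = S (n + 1) (S (n + 1) u) := by
        conv_lhs => rw [hroot n]
        rfl
      rw [← this, ih, ← Real.exp_nat_mul]
      congr 2
      rw [pow_succ]
      push_cast
      field_simp
  have hd : HasDerivWithinAt (fun t : ℝ => Real.exp (t * Real.log μ) • u) (Real.log μ • u)
      (Set.Ici 0) 0 := by
    have h := (((hasDerivAt_id (0 : ℝ)).mul_const (Real.log μ)).exp.smul_const u)
    simpa using h.hasDerivWithinAt
  have := hd.tendsto_dyadic one_pos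
  simpa [hSn] using this

lemma re_inner_le_sum_add {T : H →L[ℂ] H} (hT : IsSelfAdjoint T) {ι : Type*} [Fintype ι]
    {u : ι → H} (hu : Orthonormal ℂ u) {μ : ι → ℝ} (hTu : ∀ i, T (u i) = μ i • u i)
    {ε : ℝ} (hε : 0 ≤ ε)
    (hperp : ∀ q, (∀ i, (⟪u i, q⟫_ℂ : ℂ) = 0) → (⟪q, T q⟫_ℂ : ℂ).re ≤ ε * ‖q‖ ^ 2) (v : H) :
    (⟪v, T v⟫_ℂ : ℂ).re ≤ ∑ i, μ i * ‖(⟪u i, v⟫_ℂ : ℂ)‖ ^ 2 + ε * ‖v‖ ^ 2 := by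
  set p := ∑ i, (⟪u i, v⟫_ℂ : ℂ) • u i with hp
  set q := v - p with hq
  have hv : v = p + q := by rw [hq]; abel
  have huq : ∀ i, (⟪u i, q⟫_ℂ : ℂ) = 0 := fun i => by
    rw [hq, inner_sub_right, hp, hu.inner_right_fintype, sub_self]
  have hmul : ∀ i, (⟪u i, v⟫_ℂ : ℂ) * ⟪v, u i⟫_ℂ = ((‖(⟪u i, v⟫_ℂ : ℂ)‖ ^ 2 : ℝ) : ℂ) := fun i => by
    rw [← inner_conj_symm v, Complex.mul_conj, Complex.normSq_eq_norm_sq]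
  have hTp : T p = ∑ i, (⟪u i, v⟫_ℂ : ℂ) • (μ i • u i) := by
    rw [hp, map_sum]
    exact Finset.sum_congr rfl fun i _ => by rw [map_smul, hTu]
  have hvTp : (⟪v, T p⟫_ℂ : ℂ).re = ∑ i, μ i * ‖(⟪u i, v⟫_ℂ : ℂ)‖ ^ 2 := by
    rw [hTp, inner_sum, Complex.re_sum]
    refine Finset.sum_congr rfl fun i _ => ?_
    rw [smul_comm, inner_smul_right_eq_smul, inner_smul_right, hmul, Complex.smul_re,
      Complex.ofReal_re, smul_eq_mul]
  have hTpq : (⟪T p, q⟫_ℂ : ℂ) = 0 := by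
    rw [hTp, sum_inner]
    refine Finset.sum_eq_zero fun i _ => ?_
    rw [smul_comm, inner_smul_left_eq_smul, inner_smul_left, huq, mul_zero, smul_zero]
  have hpq : (⟪p, q⟫_ℂ : ℂ) = 0 := by
    rw [hp, sum_inner]
    exact Finset.sum_eq_zero fun i _ => by rw [inner_smul_left, huq, mul_zero]
  have hvTq : (⟪v, T q⟫_ℂ : ℂ) = ⟪q, T q⟫_ℂ := by
    rw [← ContinuousLinearMap.adjoint_inner_left, hT.adjoint_eq]
    conv_lhs => rw [hv]
    rw [map_add, inner_add_left, hTpq, zero_add, ← hT.adjoint_eq,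
      ContinuousLinearMap.adjoint_inner_left, hT.adjoint_eq]
  have hqv : ‖q‖ ^ 2 ≤ ‖v‖ ^ 2 := by
    have := norm_add_sq_eq_norm_sq_add_norm_sq_of_inner_eq_zero p q hpq
    rw [← hv] at this
    nlinarith [mul_self_nonneg ‖p‖]
  have hsplit : (⟪v, T v⟫_ℂ : ℂ) = ⟪v, T p⟫_ℂ + ⟪v, T q⟫_ℂ := by
    rw [← inner_add_right, ← map_add, ← hv]
  rw [hsplit, Complex.add_re, hvTp, hvTq]
  have := hperp q huq
  have := mul_le_mul_of_nonneg_left hqv hε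
  linarith

/-- Peierls-type comparison: if `K` is trace class and dominates `κ exp ⟪w, log (S 0) w⟫` on unit
vectors `w` in the domain of `log (S 0)`, then `S 0` is trace class. -/
lemma isTraceClassPos_of_dyadic_comparison {S : ℕ → H →L[ℂ] H} (hS : ∀ n, 0 ≤ S n)
    (hroot : ∀ n, S n = (S (n + 1)).comp (S (n + 1))) {K : H →L[ℂ] H} (hK : IsTraceClassPos K)
    (hKpos : ∀ w, 0 ≤ (⟪w, K w⟫_ℂ : ℂ).re) {κ : ℝ} (hκ : 0 < κ)
    (hcmp : ∀ w z : H, ‖w‖ = 1 →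
      Tendsto (fun n : ℕ => (2 ^ n : ℝ) • (S n w - w)) atTop (𝓝 z) →
      κ * Real.exp (⟪w, z⟫_ℂ : ℂ).re ≤ (⟪w, K w⟫_ℂ : ℂ).re) :
    IsTraceClassPos (S 0) := by
  set T := S 0 with hTdef
  have hT : 0 ≤ T := hS 0
  have hTsa : IsSelfAdjoint T := hT.isSelfAdjoint
  have hpow : ∀ n, T = S n ^ 2 ^ n := by
    intro n
    induction n with
    | zero => simp [hTdef]
    | succ n ih =>
      rw [ih, pow_succ' 2 n, pow_mul, sq]
      congr 1
      exact hroot n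
  have hScfc : ∀ n, S n = cfc (fun x : ℝ => x ^ (((2 ^ n : ℕ) : ℝ)⁻¹)) T := fun n => by
    conv_rhs => rw [hpow n]
    exact (cfc_rpow_pow (hS n) (2 ^ n) (by positivity)).symm
  obtain ⟨C, hC⟩ := hK.exists_sum_le
  refine ⟨C / κ, fun s hs1 hs2 => ?_⟩
  have key : ∀ ε > 0, ∑ v ∈ s, (⟪v, T v⟫_ℂ : ℂ).re ≤ C / κ + ε * s.card := by
    intro ε hε
    set F := cfc (fun x : ℝ => max (x - ε) 0) T with hF
    have hFsa : IsSelfAdjoint F := cfc_predicate _ _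
    have hfc : Continuous fun x : ℝ => max (x - ε) 0 := by fun_prop
    let W : Submodule ℂ H := LinearMap.range F.toLinearMap
    have hWbound : ∀ w ∈ W, ‖w‖ = 1 → κ * ε ≤ (⟪w, K w⟫_ℂ : ℂ).re := by
      rintro w ⟨v, rfl⟩ hw
      change ‖F v‖ = 1 at hw
      have hlim := tendsto_dyadic_cfc T hε
      simp only [← hScfc, ← hF] at hlim
      have hlim' := ((ContinuousLinearMap.apply ℂ H v).continuous.tendsto _).comp hlim
      refine le_trans ?_ (hcmp (F v) _ hw hlim')
      have h1 := log_mul_sq_norm_le_re_inner_cfc hT hε v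
      rw [← hF, hw, one_pow, mul_one] at h1
      gcongr
      exact (Real.log_le_iff_le_exp hε).1 h1
    have hWfd : FiniteDimensional ℂ W := hK.finiteDimensional (mul_pos hκ hε) hWbound
    have hcomm : ∀ v, T (F v) = F (T v) := by
      have := cfc_commute_cfc (fun x : ℝ => x) (fun x : ℝ => max (x - ε) 0) T
      rw [cfc_id' ℝ T, ← hF] at this
      exact fun v => congrArg (fun G : H →L[ℂ] H => G v) this.eq
    have hinv : ∀ w ∈ W, (T : H →ₗ[ℂ] H) w ∈ W := by
      rintro w ⟨v, rfl⟩
      exact ⟨T v, (hcomm v).symm⟩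
    have hsym := (ContinuousLinearMap.isSelfAdjoint_iff_isSymmetric.1 hTsa).restrict_invariant hinv
    let e := hsym.eigenvectorBasis rfl
    let μ := hsym.eigenvalues rfl
    let u : Fin (Module.finrank ℂ W) → H := fun i => e i
    have hu : Orthonormal ℂ u := e.orthonormal.comp_linearIsometry W.subtypeₗᵢ
    have hTu : ∀ i, T (u i) = μ i • u i := fun i => by
      exact (congrArg Subtype.val (hsym.apply_eigenvectorBasis rfl i)).trans rfl
    have huu : ∀ i, (⟪u i, u i⟫_ℂ : ℂ) = 1 := fun i => by
      rw [inner_self_eq_norm_sq_to_K, hu.1 i]; simp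
    have hμ : ∀ i, 0 ≤ μ i := fun i => by
      have := re_inner_nonneg_of_nonneg hT (u i)
      rw [hTu, inner_smul_right_eq_smul, huu] at this
      simpa using this
    have hμK : ∀ i, κ * μ i ≤ (⟪u i, K (u i)⟫_ℂ : ℂ).re := fun i => by
      rcases (hμ i).eq_or_lt with h | h
      · rw [← h, mul_zero]
        exact hKpos _
      · have := hcmp (u i) _ (hu.1 i) (tendsto_dyadic_eigenvector hS hroot h (hTu i))
        rw [inner_smul_right_eq_smul, huu] at this
        simpa [Real.exp_log h] using this
    have hsum : ∑ i, μ i ≤ C / κ := by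
      rw [le_div_iff₀' hκ, Finset.mul_sum]
      exact (Finset.sum_le_sum fun i _ => hμK i).trans (hC _ u hu)
    have hTF : 0 ≤ F + algebraMap ℝ (H →L[ℂ] H) ε - T := by
      have hfε : Continuous fun x : ℝ => max (x - ε) 0 + ε := by fun_prop
      have h : F + algebraMap ℝ (H →L[ℂ] H) ε - T
          = cfc (fun x : ℝ => max (x - ε) 0 + ε - x) T := by
        rw [cfc_sub (fun x : ℝ => max (x - ε) 0 + ε) (fun x => x) T hfε.continuousOn
          continuous_id'.continuousOn, cfc_id' ℝ T, cfc_add_const ε _ T hfc.continuousOn]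
      rw [h]
      exact cfc_nonneg fun x _ => by linarith [le_max_left (x - ε) 0]
    have hperp : ∀ q, (∀ i, (⟪u i, q⟫_ℂ : ℂ) = 0) → (⟪q, T q⟫_ℂ : ℂ).re ≤ ε * ‖q‖ ^ 2 := by
      intro q hq
      have hqW : (⟪F q, q⟫_ℂ : ℂ) = 0 := by
        have h1 : F q = ∑ i, (e.repr ⟨F q, q, rfl⟩ i : ℂ) • u i := by
          have := congrArg Subtype.val (e.sum_repr ⟨F q, q, rfl⟩)
          simpa [u] using this.symm
        rw [h1, sum_inner]
        exact Finset.sum_eq_zero fun i _ => by rw [inner_smul_left, hq, mul_zero]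
      have hqF : (⟪q, F q⟫_ℂ : ℂ) = 0 := by rw [← inner_conj_symm, hqW, map_zero]
      have h2 := re_inner_nonneg_of_nonneg hTF q
      have h3 : (⟪q, q⟫_ℂ : ℂ).re = ‖q‖ ^ 2 := inner_self_eq_norm_sq (𝕜 := ℂ) q
      have h4 : (algebraMap ℝ (H →L[ℂ] H) ε) q = ε • q := by
        rw [Algebra.algebraMap_eq_smul_one]; rfl
      rw [sub_apply, add_apply, inner_sub_right, inner_add_right, hqF, zero_add, h4,
        inner_smul_right_eq_smul, Complex.sub_re, Complex.smul_re, h3, smul_eq_mul] at h2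
      linarith
    have hons : Orthonormal ℂ (Subtype.val : s → H) :=
      ⟨fun v => hs1 v v.2, fun v w hvw => hs2 v v.2 w w.2 fun h => hvw (Subtype.ext h)⟩
    have hbessel : ∀ i, ∑ v ∈ s, ‖(⟪u i, v⟫_ℂ : ℂ)‖ ^ 2 ≤ 1 := fun i => by
      have := hons.sum_inner_products_le (x := u i) (s := Finset.univ)
      rw [hu.1 i, one_pow, Finset.univ_eq_attach,
        Finset.sum_attach s fun v => ‖(⟪v, u i⟫_ℂ : ℂ)‖ ^ 2] at this
      simpa only [norm_inner_symm] using this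
    calc ∑ v ∈ s, (⟪v, T v⟫_ℂ : ℂ).re
        ≤ ∑ v ∈ s, (∑ i, μ i * ‖(⟪u i, v⟫_ℂ : ℂ)‖ ^ 2 + ε) := by
          refine Finset.sum_le_sum fun v hv => ?_
          have := re_inner_le_sum_add hTsa hu hTu hε.le hperp v
          rwa [hs1 v hv, one_pow, mul_one] at this
      _ = ∑ i, μ i * ∑ v ∈ s, ‖(⟪u i, v⟫_ℂ : ℂ)‖ ^ 2 + ε * s.card := by
          rw [Finset.sum_add_distrib, Finset.sum_comm, Finset.sum_const, nsmul_eq_mul,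
            mul_comm (s.card : ℝ) ε]
          exact congrArg (· + _) (Finset.sum_congr rfl fun i _ => (Finset.mul_sum _ _ _).symm)
      _ ≤ ∑ i, μ i + ε * s.card := by
          exact add_le_add
            (Finset.sum_le_sum fun i _ => mul_le_of_le_one_right (hμ i) (hbessel i)) le_rfl
      _ ≤ C / κ + ε * s.card := add_le_add hsum le_rfl
  refine ge_of_tendsto (f := fun ε : ℝ => C / κ + ε * s.card) (x := 𝓝[>] 0) ?_
    (by filter_upwards [self_mem_nhdsWithin] with ε hε using key ε hε)
  have : Continuous fun ε : ℝ => C / κ + ε * s.card := by fun_prop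
  simpa using (this.tendsto 0).mono_left nhdsWithin_le_nhds

lemma IsHeatSemigroup.exists_apply_eq_of_dyadic {E : ℝ → H →L[ℂ] H} {B : H →ₗ.[ℂ] H}
    (hE : IsHeatSemigroup E B) (hB : IsSelfAdjoint B) {τ : ℝ} (hτ : 0 < τ) {w z : H}
    (hlim : Tendsto (fun n : ℕ => (2 ^ n : ℝ) • (E (τ / 2 ^ n) w - w)) atTop (𝓝 z)) :
    ∃ ψ : B.domain, (ψ : H) = w ∧ B ψ = -(τ⁻¹ • z) := by
  refine LinearPMap.exists_apply_eq_of_weak hB fun x => ?_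
  have h1 := (hE.generator x).tendsto_dyadic hτ
  simp only [hE.zero, one_apply_eq_self] at h1
  have h2 : Tendsto (fun n : ℕ => (⟪w, (2 ^ n : ℝ) • (E (τ / 2 ^ n) x - x)⟫_ℂ : ℂ)) atTop
      (𝓝 ⟪w, τ • -(B x)⟫_ℂ) := tendsto_const_nhds.inner h1
  have h3 : Tendsto (fun n : ℕ => (⟪(2 ^ n : ℝ) • (E (τ / 2 ^ n) w - w), (x : H)⟫_ℂ : ℂ)) atTop
      (𝓝 ⟪z, (x : H)⟫_ℂ) := hlim.inner tendsto_const_nhds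
  have h4 : (⟪z, (x : H)⟫_ℂ : ℂ) = ⟪w, τ • -(B x)⟫_ℂ := by
    refine tendsto_nhds_unique h3 (h2.congr fun n => ?_)
    have hsa := hE.selfadj (τ / 2 ^ n) (by positivity)
    rw [inner_smul_right_eq_smul, inner_smul_left_eq_smul, inner_sub_left, inner_sub_right,
      ← ContinuousLinearMap.adjoint_inner_left, hsa.adjoint_eq]
  rw [inner_neg_left, inner_smul_left_eq_smul, h4, inner_smul_right_eq_smul, inner_neg_right,
    smul_smul, inv_mul_cancel₀ hτ.ne', one_smul, neg_neg]

lemma IsHeatSemigroup.isTraceClassPos_of_le {E : ℝ → H →L[ℂ] H} {B : H →ₗ.[ℂ] H}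
    (hE : IsHeatSemigroup E B) {τ β : ℝ} (hτ : 0 ≤ τ) (hβ : τ ≤ β) (h : IsTraceClassPos (E τ)) :
    IsTraceClassPos (E β) := by
  obtain ⟨C, hC⟩ := h
  refine ⟨‖E (β - τ)‖ * C, fun s hs1 hs2 => ?_⟩
  have hle : ∀ v, (⟪v, E β v⟫_ℂ : ℂ).re ≤ ‖E (β - τ)‖ * (⟪v, E τ v⟫_ℂ : ℂ).re := by
    intro v
    have hd : 0 ≤ β - τ := by linarith
    have hsa := hE.selfadj (τ / 2) (by positivity)
    have h1 : E β = (E (τ / 2)).comp ((E (β - τ)).comp (E (τ / 2))) := by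
      rw [← hE.semigroup _ _ hd (by positivity),
        ← hE.semigroup _ _ (by positivity) (by positivity)]
      congr 1
      ring
    have h2 : E τ = (E (τ / 2)).comp (E (τ / 2)) := by
      rw [← hE.semigroup _ _ (by positivity) (by positivity), add_halves]
    have h3 : (⟪v, E τ v⟫_ℂ : ℂ).re = ‖E (τ / 2) v‖ ^ 2 := by
      rw [h2]
      exact hsa.inner_mul_self v
    have h4 : (⟪v, E β v⟫_ℂ : ℂ) = ⟪E (τ / 2) v, E (β - τ) (E (τ / 2) v)⟫_ℂ := by
      rw [h1, ContinuousLinearMap.comp_apply, ContinuousLinearMap.comp_apply,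
        ← ContinuousLinearMap.adjoint_inner_left, hsa.adjoint_eq]
    rw [h3, h4]
    calc (⟪E (τ / 2) v, E (β - τ) (E (τ / 2) v)⟫_ℂ : ℂ).re
        ≤ ‖E (τ / 2) v‖ * ‖E (β - τ) (E (τ / 2) v)‖ :=
          (Complex.re_le_norm _).trans (norm_inner_le_norm _ _)
      _ ≤ ‖E (τ / 2) v‖ * (‖E (β - τ)‖ * ‖E (τ / 2) v‖) := by
          gcongr
          exact (E (β - τ)).le_opNorm _
      _ = ‖E (β - τ)‖ * ‖E (τ / 2) v‖ ^ 2 := by ring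
  calc ∑ v ∈ s, (⟪v, E β v⟫_ℂ : ℂ).re ≤ ∑ v ∈ s, ‖E (β - τ)‖ * (⟪v, E τ v⟫_ℂ : ℂ).re :=
        Finset.sum_le_sum fun v _ => hle v
    _ = ‖E (β - τ)‖ * ∑ v ∈ s, (⟪v, E τ v⟫_ℂ : ℂ).re := by rw [Finset.mul_sum]
    _ ≤ ‖E (β - τ)‖ * C := by
        gcongr
        exact hC s hs1 hs2

end Auxiliary

/-- **(Streater 98.)** Let `H₀ ≥ I` be self-adjoint with `e^{-β₀H₀}` trace class for some
`0 < β₀ < 1` (here `A = H₀^{1/2}`, so `q₀(ψ,ψ) = ‖Aψ‖²`), and let `X` be `q₀`-bounded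
with relative bound `a < 1 - β₀`.  If `H_X` is the KLMN operator representing `q₀ + X`,
then `e^{-βH_X}` is trace class for all `β > β₀/(1-a)`. -/
theorem exp_perturbed_traceClass
    (A : H →ₗ.[ℂ] H) (hdense : Dense (A.domain : Set H)) (hsaA : IsSelfAdjoint A)
    (hge : ∀ ψ : A.domain, ‖(ψ : H)‖ ≤ ‖A ψ‖)  -- `H₀ ≥ I`
    (β₀ : ℝ) (hβ0 : 0 < β₀) (hβ1 : β₀ < 1)
    (E0 : ℝ → H →L[ℂ] H)
    (hE0 : ∀ ψ : A.domain, ∀ h : (A ψ : H) ∈ A.domain,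
      HasDerivWithinAt (fun t => E0 t (ψ : H)) (-(A ⟨A ψ, h⟩)) (Set.Ici (0 : ℝ)) 0)
    (hE0sg : ∀ s t : ℝ, 0 ≤ s → 0 ≤ t → E0 (s + t) = (E0 s).comp (E0 t))
    (hE00 : E0 0 = 1) (hE0sa : ∀ t : ℝ, 0 ≤ t → IsSelfAdjoint (E0 t))
    (htr0 : IsTraceClassPos (E0 β₀))
    (X : A.domain → A.domain → ℂ)
    (hlin : ∀ φ, IsLinearMap ℂ (X φ))
    (hsymm : ∀ φ ψ : A.domain, X φ ψ = starRingEnd ℂ (X ψ φ))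
    (a b : ℝ) (ha0 : 0 ≤ a) (ha : a < 1 - β₀) (hb : 0 ≤ b)
    (hbound : ∀ ψ : A.domain, ‖X ψ ψ‖ ≤ a * ‖A ψ‖ ^ 2 + b * ‖(ψ : H)‖ ^ 2)
    -- `H_X`: the KLMN operator representing the form `q₀ + X`
    (B : H →ₗ.[ℂ] H) (hsaB : IsSelfAdjoint B)
    (hBdom : ∀ ψ : B.domain, (ψ : H) ∈ A.domain)
    (hBrep : ∀ (φ : A.domain) (ψ : B.domain),
      (⟪(φ : H), B ψ⟫_ℂ : ℂ) =
        ⟪A φ, A ⟨(ψ : H), hBdom ψ⟩⟫_ℂ + X φ ⟨(ψ : H), hBdom ψ⟩)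
    (EX : ℝ → H →L[ℂ] H) (hEX : IsHeatSemigroup EX B) :
    ∀ β : ℝ, β₀ / (1 - a) < β → IsTraceClassPos (EX β) := by
  intro β hβ
  have ha1 : 0 < 1 - a := hβ0.trans (by linarith)
  have hτ : 0 < β₀ / (1 - a) := div_pos hβ0 ha1
  refine hEX.isTraceClassPos_of_le hτ.le hβ.le ?_
  set τ := β₀ / (1 - a) with hτdef
  have hβτ : τ * (1 - a) = β₀ := div_mul_cancel₀ _ ha1.ne'
  have hE0pos : ∀ w, 0 ≤ (⟪w, E0 β₀ w⟫_ℂ : ℂ).re := fun w => by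
    have hhalf : (0 : ℝ) ≤ β₀ / 2 := by positivity
    have : E0 β₀ = (E0 (β₀ / 2)).comp (E0 (β₀ / 2)) := by
      rw [← hE0sg _ _ hhalf hhalf, add_halves]
    rw [this]
    exact ((hE0sa _ hhalf).inner_mul_self w).symm ▸ sq_nonneg _
  have := isTraceClassPos_of_dyadic_comparison (S := fun n => EX (τ / 2 ^ n))
    (fun n => (ContinuousLinearMap.nonneg_iff_isPositive _).2 (hEX.pos _ (by positivity)))
    (fun n => by
      rw [← hEX.semigroup _ _ (by positivity) (by positivity), pow_succ]
      congr 1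
      field_simp
      norm_num) htr0 hE0pos (Real.exp_pos (-(τ * b))) ?_
  · simpa using this
  intro w z hw hlim
  obtain ⟨ψ, rfl, hBψ⟩ := hEX.exists_apply_eq_of_dyadic hsaB hτ hlim
  set φ : A.domain := ⟨ψ, hBdom ψ⟩ with hφ
  have hrep := congrArg Complex.re (hBrep φ ψ)
  have hAA : (⟪A φ, A φ⟫_ℂ : ℂ).re = ‖A φ‖ ^ 2 := inner_self_eq_norm_sq (𝕜 := ℂ) (A φ)
  rw [Complex.add_re, hAA, hBψ, inner_neg_right, inner_smul_right_eq_smul, Complex.neg_re,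
    Complex.smul_re, smul_eq_mul] at hrep
  have hX := (abs_le.1 ((Complex.abs_re_le_norm _).trans (hbound φ))).1
  have hφn : ‖(φ : H)‖ = 1 := hw
  have hne : (φ : H) ≠ 0 := norm_ne_zero_iff.1 (by rw [hφn]; exact one_ne_zero)
  have hlow := mul_exp_neg_le_re_inner hsaA hge hβ0 hE0 hE0sg hE00 hE0sa φ hne
  rw [hφn] at hX hlow
  simp only [one_pow, one_mul, div_one, mul_one] at hX hlow
  refine le_trans ?_ hlow
  rw [← Real.exp_add, Real.exp_le_exp]
  change -(τ * b) + (⟪(φ : H), z⟫_ℂ : ℂ).re ≤ -(β₀ * ‖A φ‖ ^ 2)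
  have hq : (1 - a) * ‖A φ‖ ^ 2 - b ≤ -(τ⁻¹ * (⟪(φ : H), z⟫_ℂ : ℂ).re) := by
    rw [hrep]
    linarith
  have hq' := mul_le_mul_of_nonneg_left hq hτ.le
  rw [mul_neg, mul_inv_cancel_left₀ hτ.ne', mul_sub, ← mul_assoc, hβτ] at hq'
  linarith
end

section
/- Let ρ₀ ∈ C_{β₀} ∩ Σ with β₀ < 1 and let X be a q₀-bounded symmetric form. The regularized mean ρ₀·X := Tr(ρ₀^λ X ρ₀^{1−λ}) is finite and independent of λ ∈ (0,1). -/
open scoped InnerProductSpace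
open Complex

variable {H : Type} [NormedAddCommGroup H] [InnerProductSpace ℂ H] [CompleteSpace H]

set_option linter.unusedSectionVars false

/-- `S` has a trace in the basis `e`, and this trace is cyclic with respect to bounded factors. -/
def HasCyclicTrace {ι : Type} (e : HilbertBasis ι ℂ H) (S : H →L[ℂ] H) : Prop :=
  ∀ P : H →L[ℂ] H, ∃ c : ℂ, HasSum (fun i => (⟪e i, P (S (e i))⟫_ℂ : ℂ)) c ∧
    HasSum (fun i => (⟪e i, S (P (e i))⟫_ℂ : ℂ)) c

theorem HasCyclicTrace.add {ι : Type} {e : HilbertBasis ι ℂ H} {S T : H →L[ℂ] H}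
    (hS : HasCyclicTrace e S) (hT : HasCyclicTrace e T) : HasCyclicTrace e (S + T) := by
  intro P
  obtain ⟨c, h1, h2⟩ := hS P
  obtain ⟨d, h3, h4⟩ := hT P
  refine ⟨c + d, ?_, ?_⟩
  · simpa [inner_add_right] using h1.add h3
  · simpa [inner_add_right] using h2.add h4

theorem HilbertBasis.tsum_norm_inner_mul_inner_le {ι : Type} (e : HilbertBasis ι ℂ H) (u v : H) :
    ∑' i, ‖(⟪v, e i⟫_ℂ * ⟪e i, u⟫_ℂ : ℂ)‖ ≤ ‖u‖ * ‖v‖ := by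
  refine Real.tsum_le_of_sum_le (fun i => norm_nonneg _) fun s => ?_
  calc ∑ i ∈ s, ‖(⟪v, e i⟫_ℂ * ⟪e i, u⟫_ℂ : ℂ)‖
      = ∑ i ∈ s, ‖(⟪e i, v⟫_ℂ : ℂ)‖ * ‖(⟪e i, u⟫_ℂ : ℂ)‖ := by
        simp_rw [norm_mul, norm_inner_symm v]
    _ ≤ √(∑ i ∈ s, ‖(⟪e i, v⟫_ℂ : ℂ)‖ ^ 2) * √(∑ i ∈ s, ‖(⟪e i, u⟫_ℂ : ℂ)‖ ^ 2) :=
        Real.sum_mul_le_sqrt_mul_sqrt _ _ _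
    _ ≤ ‖v‖ * ‖u‖ := by
        gcongr
        · exact Real.sqrt_le_iff.2 ⟨norm_nonneg _, e.orthonormal.sum_inner_products_le v⟩
        · exact Real.sqrt_le_iff.2 ⟨norm_nonneg _, e.orthonormal.sum_inner_products_le u⟩
    _ = ‖u‖ * ‖v‖ := mul_comm _ _

theorem hasSum_inner_of_nuclear {ι κ : Type} (e : HilbertBasis ι ℂ H) {u v : κ → H}
    (hs : Summable fun j => ‖u j‖ * ‖v j‖) {T : H → H}
    (hT : ∀ y, HasSum (fun j => (⟪v j, y⟫_ℂ : ℂ) • u j) (T y)) :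
    HasSum (fun i => (⟪e i, T (e i)⟫_ℂ : ℂ)) (∑' j, (⟪v j, u j⟫_ℂ : ℂ)) := by
  let g : κ × ι → ℂ := fun p => ⟪v p.1, e p.2⟫_ℂ * ⟪e p.2, u p.1⟫_ℂ
  have hg : Summable g := by
    refine Summable.of_norm ((summable_prod_of_nonneg fun p => norm_nonneg _).2 ⟨fun j => ?_, ?_⟩)
    · exact (e.summable_inner_mul_inner (v j) (u j)).norm
    · exact Summable.of_nonneg_of_le (fun j => tsum_nonneg fun i => norm_nonneg _)
        (fun j => e.tsum_norm_inner_mul_inner_le (u j) (v j)) hs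
  have h1 : ∑' p, g p = ∑' j, (⟪v j, u j⟫_ℂ : ℂ) := by
    rw [hg.tsum_prod]
    exact tsum_congr fun j => e.tsum_inner_mul_inner (v j) (u j)
  rw [← h1]
  have h2 : HasSum (fun p : ι × κ => g (p.2, p.1)) (∑' p, g p) :=
    (Equiv.prodComm ι κ).hasSum_iff.2 hg.hasSum
  refine h2.prod_fiberwise fun i => ?_
  have := (hT (e i)).mapL (innerSL ℂ (e i))
  simpa [g, inner_smul_right] using this

theorem HasCyclicTrace.of_nuclear {ι κ : Type} (e : HilbertBasis ι ℂ H) {u v : κ → H}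
    (hs : Summable fun j => ‖u j‖ * ‖v j‖) {S : H →L[ℂ] H}
    (hS : ∀ y, HasSum (fun j => (⟪v j, y⟫_ℂ : ℂ) • u j) (S y)) : HasCyclicTrace e S := by
  intro P
  refine ⟨∑' j, (⟪v j, P (u j)⟫_ℂ : ℂ), ?_, ?_⟩
  · refine hasSum_inner_of_nuclear e (u := fun j => P (u j)) (v := v)
      (T := fun y => P (S y)) ?_ fun y => ?_
    · refine Summable.of_nonneg_of_le (fun j => by positivity) (fun j => ?_) (hs.mul_left ‖P‖)
      rw [← mul_assoc]
      gcongr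
      exact P.le_opNorm _
    · simpa using (hS y).mapL P
  · have := hasSum_inner_of_nuclear e (u := u) (v := fun j => P.adjoint (v j))
      (T := fun y => S (P y)) ?_ fun y => ?_
    · simpa [ContinuousLinearMap.adjoint_inner_left] using this
    · refine Summable.of_nonneg_of_le (fun j => by positivity) (fun j => ?_)
        (hs.mul_left ‖P.adjoint‖)
      rw [mul_left_comm]
      gcongr
      exact P.adjoint.le_opNorm _
    · simpa [ContinuousLinearMap.adjoint_inner_left] using hS (P y)

theorem exists_hasSum_of_nuclear {κ : Type} {u v : κ → H}
    (hs : Summable fun j => ‖u j‖ * ‖v j‖) :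
    ∃ S : H →L[ℂ] H, ∀ y, HasSum (fun j => (⟪v j, y⟫_ℂ : ℂ) • u j) (S y) := by
  have : Summable fun j => InnerProductSpace.rankOne ℂ (u j) (v j) :=
    Summable.of_norm (by simpa using hs)
  refine ⟨∑' j, InnerProductSpace.rankOne ℂ (u j) (v j), fun y => ?_⟩
  simpa using this.hasSum.mapL (ContinuousLinearMap.apply ℂ H y)

theorem HilbertBasis.exists_inner_eq_of_norm_le {κ : Type} (f : HilbertBasis κ ℂ H) (z : H)
    (c : κ → ℂ) {M : ℝ} (hM : 0 ≤ M) (hc : ∀ i, ‖c i‖ ≤ M * ‖(⟪f i, z⟫_ℂ : ℂ)‖) :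
    ∃ u : H, (∀ i, (⟪f i, u⟫_ℂ : ℂ) = c i) ∧ ‖u‖ ≤ M * ‖z‖ := by
  have hsq : ∀ s : Finset κ, ∑ i ∈ s, ‖c i‖ ^ (2 : ℝ) ≤ (M * ‖z‖) ^ (2 : ℝ) := fun s => by
    simp only [Real.rpow_two]
    calc ∑ i ∈ s, ‖c i‖ ^ 2 ≤ ∑ i ∈ s, M ^ 2 * ‖(⟪f i, z⟫_ℂ : ℂ)‖ ^ 2 := by
          refine Finset.sum_le_sum fun i _ => ?_
          rw [← mul_pow]
          exact pow_le_pow_left₀ (norm_nonneg _) (hc i) 2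
      _ = M ^ 2 * ∑ i ∈ s, ‖(⟪f i, z⟫_ℂ : ℂ)‖ ^ 2 := by rw [Finset.mul_sum]
      _ ≤ M ^ 2 * ‖z‖ ^ 2 := by
          gcongr
          exact f.orthonormal.sum_inner_products_le z
      _ = (M * ‖z‖) ^ 2 := (mul_pow _ _ _).symm
  have hmem : Memℓp c 2 := memℓp_gen' (C := (M * ‖z‖) ^ (2 : ℝ)) (by simpa using hsq)
  refine ⟨f.repr.symm ⟨c, hmem⟩, fun i => ?_, ?_⟩
  · rw [← f.repr_apply_apply, LinearIsometryEquiv.apply_symm_apply]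
  · rw [LinearIsometryEquiv.norm_map]
    exact lp.norm_le_of_forall_sum_le (by simp) (by positivity) (by simpa using hsq)

theorem HilbertBasis.clm_ext {κ : Type} (f : HilbertBasis κ ℂ H) {S T : H →L[ℂ] H}
    (h : ∀ i j, (⟪f i, S (f j)⟫_ℂ : ℂ) = ⟪f i, T (f j)⟫_ℂ) : S = T := by
  refine ContinuousLinearMap.ext_on (s := Set.range f) ?_ ?_
  · exact Submodule.dense_iff_topologicalClosure_eq_top.2 f.dense_span
  · rintro _ ⟨j, rfl⟩
    apply f.repr.injective
    ext i
    rw [f.repr_apply_apply, f.repr_apply_apply, h]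

theorem HasCyclicTrace.of_weights {ι κ : Type} (e : HilbertBasis ι ℂ H) (f : HilbertBasis κ ℂ H)
    {μ : κ → ℝ} (hμ0 : ∀ j, 0 ≤ μ j) (hμ : Summable μ) {θ : ℝ} (h0 : 0 < θ) (h1 : θ < 1)
    (B S : H →L[ℂ] H)
    (hS : ∀ i j, (⟪f i, S (f j)⟫_ℂ : ℂ) =
      ((μ i ^ θ * μ j ^ (1 - θ) : ℝ) : ℂ) * ⟪f i, B (f j)⟫_ℂ) :
    HasCyclicTrace e S := by
  classical
  have hw : ∀ i j, ∀ m, μ i ≤ m → μ j ≤ m → μ i ^ θ * μ j ^ (1 - θ) ≤ m := by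
    intro i j m hi hj
    have hm := (hμ0 i).trans hi
    calc μ i ^ θ * μ j ^ (1 - θ) ≤ m ^ θ * m ^ (1 - θ) :=
          mul_le_mul (Real.rpow_le_rpow (hμ0 i) hi h0.le)
            (Real.rpow_le_rpow (hμ0 j) hj (by linarith)) (Real.rpow_nonneg (hμ0 j) _)
            (Real.rpow_nonneg hm _)
      _ = m := by
          rw [← Real.rpow_add_of_nonneg hm h0.le (by linarith), add_sub_cancel, Real.rpow_one]
  have hw0 : ∀ i j, 0 ≤ μ i ^ θ * μ j ^ (1 - θ) := fun i j =>
    mul_nonneg (Real.rpow_nonneg (hμ0 i) _) (Real.rpow_nonneg (hμ0 j) _)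
  have hu : ∀ j, ∃ u : H, (∀ i, (⟪f i, u⟫_ℂ : ℂ) =
      if μ i ≤ μ j then ⟪f i, S (f j)⟫_ℂ else 0) ∧ ‖u‖ ≤ μ j * ‖B (f j)‖ := fun j => by
    refine f.exists_inner_eq_of_norm_le (B (f j)) _ (hμ0 j) fun i => ?_
    split_ifs with h
    · rw [hS, norm_mul, Complex.norm_real, Real.norm_of_nonneg (hw0 i j)]
      gcongr
      exact hw i j _ h le_rfl
    · rw [norm_zero]
      exact mul_nonneg (hμ0 j) (norm_nonneg _)
  have hv : ∀ i, ∃ v : H, (∀ j, (⟪f j, v⟫_ℂ : ℂ) =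
      if μ i ≤ μ j then 0 else ⟪S (f j), f i⟫_ℂ) ∧ ‖v‖ ≤ μ i * ‖B.adjoint (f i)‖ := fun i => by
    refine f.exists_inner_eq_of_norm_le (B.adjoint (f i)) _ (hμ0 i) fun j => ?_
    split_ifs with h
    · rw [norm_zero]
      exact mul_nonneg (hμ0 i) (norm_nonneg _)
    · rw [← norm_inner_symm, hS, norm_mul, Complex.norm_real, Real.norm_of_nonneg (hw0 i j),
        ContinuousLinearMap.adjoint_inner_right, norm_inner_symm (B (f j))]
      gcongr
      exact hw i j _ le_rfl (not_le.1 h).le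
  choose u hu hun using hu
  choose v hv hvn using hv
  have hf : ∀ j, ‖f j‖ = 1 := f.orthonormal.1
  have hsu : Summable fun j => ‖u j‖ * ‖f j‖ := by
    refine Summable.of_nonneg_of_le (fun j => by positivity) (fun j => ?_) (hμ.mul_right ‖B‖)
    rw [hf, mul_one]
    refine (hun j).trans (mul_le_mul_of_nonneg_left ?_ (hμ0 j))
    simpa [hf] using B.le_opNorm (f j)
  have hsv : Summable fun j => ‖f j‖ * ‖v j‖ := by
    refine Summable.of_nonneg_of_le (fun j => by positivity) (fun j => ?_)
      (hμ.mul_right ‖B.adjoint‖)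
    rw [hf, one_mul]
    refine (hvn j).trans (mul_le_mul_of_nonneg_left ?_ (hμ0 j))
    simpa only [hf, mul_one] using B.adjoint.le_opNorm (f j)
  obtain ⟨S₁, hS₁⟩ := exists_hasSum_of_nuclear hsu
  obtain ⟨S₂, hS₂⟩ := exists_hasSum_of_nuclear hsv
  have hSS : S = S₁ + S₂ := by
    refine f.clm_ext fun i j => ?_
    have e1 : S₁ (f j) = u j := by
      refine (hS₁ (f j)).unique ?_
      convert hasSum_ite_eq j (u j) using 1
      funext k
      rw [orthonormal_iff_ite.1 f.orthonormal]
      split_ifs with h <;> simp [h]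
    have e2 : (⟪f i, S₂ (f j)⟫_ℂ : ℂ) = ⟪v i, f j⟫_ℂ := by
      have hk : ∀ k, innerSL ℂ (f i) ((⟪v k, f j⟫_ℂ : ℂ) • f k) =
          if k = i then (⟪v i, f j⟫_ℂ : ℂ) else 0 := fun k => by
        rw [innerSL_apply_apply, inner_smul_right, orthonormal_iff_ite.1 f.orthonormal]
        by_cases h : i = k
        · simp [h]
        · simp [h, Ne.symm h]
      have h := (hS₂ (f j)).mapL (innerSL ℂ (f i))
      simp only [hk] at h
      exact h.unique (hasSum_ite_eq i _)
    rw [add_apply, inner_add_right, e1, e2, hu, ← inner_conj_symm (v i), hv]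
    split_ifs <;> simp
  rw [hSS]
  exact (HasCyclicTrace.of_nuclear e hsu hS₁).add (HasCyclicTrace.of_nuclear e hsv hS₂)

theorem HilbertBasis.isCompactOperator_of_sum_le {ι : Type} (e : HilbertBasis ι ℂ H)
    {Q : H →L[ℂ] H} (hQ : IsSelfAdjoint Q) {C : ℝ}
    (hC : ∀ s : Finset ι, ∑ i ∈ s, ‖Q (e i)‖ ^ 2 ≤ C) : IsCompactOperator Q := by
  have hsum : Summable fun i => ‖Q (e i)‖ ^ 2 :=
    summable_of_sum_le (fun i => sq_nonneg _) hC
  let F : ι → H →L[ℂ] H := fun i => InnerProductSpace.rankOne ℂ (e i) (Q (e i))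
  have hF : Summable F := by
    rw [summable_iff_vanishing_norm]
    intro ε hε
    obtain ⟨s, hs⟩ := summable_iff_vanishing_norm.1 hsum (ε ^ 2) (by positivity)
    refine ⟨s, fun t ht => ?_⟩
    have h1 := hs t ht
    rw [Real.norm_of_nonneg (Finset.sum_nonneg fun i _ => sq_nonneg _)] at h1
    refine lt_of_le_of_lt (ContinuousLinearMap.opNorm_le_bound _ (Real.sqrt_nonneg _)
      fun x => ?_) ((Real.sqrt_lt' hε).2 h1)
    refine abs_le_of_sq_le_sq' ?_ (by positivity) |>.2
    rw [mul_pow, Real.sq_sqrt (Finset.sum_nonneg fun i _ => sq_nonneg _), Finset.sum_mul]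
    have h2 : ((∑ i ∈ t, F i) x) = ∑ i ∈ t, (⟪Q (e i), x⟫_ℂ : ℂ) • e i := by
      simp [F, sum_apply]
    have h3 : ‖∑ i ∈ t, (⟪Q (e i), x⟫_ℂ : ℂ) • e i‖ ^ 2 =
        ∑ i ∈ t, ‖(⟪Q (e i), x⟫_ℂ : ℂ)‖ ^ 2 := by
      rw [← Complex.ofReal_inj, Complex.ofReal_pow, ← Complex.coe_algebraMap,
        ← inner_self_eq_norm_sq_to_K (𝕜 := ℂ), e.orthonormal.inner_sum]
      simp only [Complex.conj_mul', Complex.coe_algebraMap, Complex.ofReal_sum, Complex.ofReal_pow]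
    rw [h2, h3]
    refine Finset.sum_le_sum fun i _ => ?_
    rw [← mul_pow]
    exact pow_le_pow_left₀ (norm_nonneg _) (norm_inner_le_norm _ _) 2
  have hFQ : ∑' i, F i = Q := by
    ext x
    refine (hF.hasSum.mapL (ContinuousLinearMap.apply ℂ H x)).unique ?_
    convert e.hasSum_repr (Q x) using 1
    funext i
    rw [e.repr_apply_apply, ← ContinuousLinearMap.adjoint_inner_left, hQ.adjoint_eq]
    simp [F]
  have hlim : Filter.Tendsto (fun s : Finset ι => ∑ i ∈ s, F i) Filter.atTop (nhds Q) :=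
    hFQ ▸ hF.hasSum
  refine isCompactOperator_of_tendsto hlim (Filter.Eventually.of_forall fun s => ?_)
  have : ∑ i ∈ s, F i ∈ compactOperator (RingHom.id ℂ) H H := by
    refine Submodule.sum_mem _ fun i _ => ?_
    exact IsCompactOperator.clm_comp
      (isCompactOperator_of_locallyCompactSpace_dom (innerSL ℂ (Q (e i))))
      (ContinuousLinearMap.toSpanSingleton ℂ (e i))
  exact this

theorem IsCompactOperator.exists_eigenbasis {T : H →L[ℂ] H} (hT : IsCompactOperator T)
    (hpos : T.IsPositive) :
    ∃ (κ : Type) (f : HilbertBasis κ ℂ H) (μ : κ → ℝ), (∀ j, 0 ≤ μ j) ∧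
      ∀ j, T (f j) = (μ j : ℂ) • f j := by
  have hsymm : (T : H →ₗ[ℂ] H).IsSymmetric := hpos.isSymmetric
  let V : ℂ → Submodule ℂ H := fun c => Module.End.eigenspace (T : Module.End ℂ H) c
  have hclosed : ∀ c, IsClosed (V c : Set H) := fun c => by
    have : (V c : Set H) = {x | T x = c • x} := by
      ext x
      exact Module.End.mem_eigenspace_iff
    rw [this]
    exact isClosed_eq T.continuous (continuous_const_smul c)
  have hcomplete : ∀ c, CompleteSpace (V c) := fun c => (hclosed c).completeSpace_coe
  choose w b hb using fun c => exists_hilbertBasis ℂ (V c)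
  have hon : Orthonormal ℂ fun a : Σ c, w c => (V a.1).subtypeₗᵢ (b a.1 a.2) :=
    hsymm.orthogonalFamily_eigenspaces.orthonormal_sigma_orthonormal
      fun c => (b c).orthonormal
  have hbot : (Submodule.span ℂ (Set.range
      fun a : Σ c, w c => (V a.1).subtypeₗᵢ (b a.1 a.2)))ᗮ = ⊥ := by
    rw [eq_bot_iff, ← ContinuousLinearMap.orthogonalComplement_iSup_eigenspaces_eq_bot hT hsymm]
    intro x hx
    rw [Submodule.mem_orthogonal] at hx
    rw [← Submodule.iInf_orthogonal, Submodule.mem_iInf]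
    intro c
    rw [Submodule.mem_orthogonal]
    intro y hy
    have h0 : ((V c).orthogonalProjectionOnto x : V c) = 0 := by
      apply (b c).repr.injective
      ext i
      rw [(b c).repr_apply_apply, map_zero,
        Submodule.inner_orthogonalProjectionOnto_eq_of_mem_left]
      exact hx _ (Submodule.subset_span ⟨⟨c, i⟩, rfl⟩)
    have := Submodule.inner_orthogonalProjectionOnto_eq_of_mem_left (K := V c) ⟨y, hy⟩ x
    rw [h0] at this
    simpa using this.symm
  refine ⟨_, HilbertBasis.mkOfOrthogonalEqBot hon hbot,
    fun a => a.1.re, fun a => ?_, fun a => ?_⟩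
  all_goals
    have hmem : T (b a.1 a.2 : H) = a.1 • (b a.1 a.2 : H) :=
      Module.End.mem_eigenspace_iff.1 (b a.1 a.2).2
    have hn : ‖(b a.1 a.2 : H)‖ = 1 := (b a.1).orthonormal.1 a.2
    have h := hpos.inner_nonneg_right (b a.1 a.2 : H)
    rw [hmem, inner_smul_right, inner_self_eq_norm_sq_to_K, hn] at h
    simp only [Complex.coe_algebraMap, Complex.ofReal_one, one_pow, mul_one] at h
    obtain ⟨h1, h2⟩ := Complex.le_def.1 h
  · exact h1
  · rw [HilbertBasis.coe_mkOfOrthogonalEqBot]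
    have : ((a.1.re : ℝ) : ℂ) = a.1 := Complex.ext rfl h2
    rw [this]
    exact hmem

theorem ContinuousLinearMap.IsPositive.apply_eq_sqrt_smul {R : H →L[ℂ] H} (hR : R.IsPositive)
    {m : ℝ} (hm : 0 ≤ m) {x : H} (hx : R (R x) = (m : ℂ) • x) :
    R x = ((√m : ℝ) : ℂ) • x := by
  set c : ℝ := √m with hc
  have hcm : (m : ℂ) = (c : ℂ) * c := by
    rw [← Complex.ofReal_mul, Real.mul_self_sqrt hm]
  rcases (Real.sqrt_nonneg m).eq_or_lt with h0 | h0
  · rw [← hc] at h0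
    rw [hcm, ← h0] at hx
    rw [← h0, Complex.ofReal_zero, zero_smul, ← inner_self_eq_zero (𝕜 := ℂ),
      hR.inner_left_eq_inner_right, hx]
    simp
  · rw [← hc] at h0
    set g : H := R x - (c : ℂ) • x with hg
    have h1 : R g = -((c : ℂ) • g) := by
      rw [hg, map_sub, map_smul, hx, hcm, smul_sub, smul_smul]
      abel
    have h2 := hR.re_inner_nonneg_right g
    rw [h1, inner_neg_right, inner_smul_right, inner_self_eq_norm_sq_to_K] at h2
    have h3 : c * ‖g‖ ^ 2 ≤ 0 := by
      have : (c : ℂ) * (‖g‖ : ℂ) ^ 2 = ((c * ‖g‖ ^ 2 : ℝ) : ℂ) := by push_cast; rfl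
      simp only [Complex.coe_algebraMap] at h2
      rw [this, ← Complex.ofReal_neg] at h2
      rw [RCLike.re_eq_complex_re, Complex.ofReal_re] at h2
      linarith
    have h4 : ‖g‖ ^ 2 = 0 := le_antisymm (by nlinarith) (sq_nonneg _)
    exact sub_eq_zero.1 (norm_eq_zero.1 (pow_eq_zero_iff two_ne_zero |>.1 h4))

theorem apply_dyadic_eq_rpow_smul {P : ℝ → H →L[ℂ] H}
    (hPsg : ∀ s t : ℝ, 0 < s → 0 < t → P (s + t) = (P s).comp (P t))
    (hPpos : ∀ s : ℝ, 0 < s → (P s).IsPositive) {β : ℝ} (hβ : 0 < β) {x : H} {μ : ℝ}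
    (hμ : 0 ≤ μ) (hx : P β x = (μ : ℂ) • x) (k : ℕ) {m : ℕ} (hm : 0 < m) :
    P ((m / 2 ^ k : ℝ) * β) x = ((μ ^ (m / 2 ^ k : ℝ) : ℝ) : ℂ) • x := by
  have hroot : P ((1 / 2 ^ k : ℝ) * β) x = ((μ ^ (1 / 2 ^ k : ℝ) : ℝ) : ℂ) • x := by
    induction k with
    | zero => simpa using hx
    | succ k ih =>
      have hr : (0 : ℝ) < 1 / 2 ^ (k + 1) * β := by positivity
      have h1 := (hPpos _ hr).apply_eq_sqrt_smul (m := μ ^ (1 / 2 ^ k : ℝ)) (x := x)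
        (Real.rpow_nonneg hμ _) (by
          rw [← ih, ← ContinuousLinearMap.comp_apply, ← hPsg _ _ hr hr]
          have hadd : (1 / 2 ^ (k + 1) * β + 1 / 2 ^ (k + 1) * β : ℝ) = 1 / 2 ^ k * β := by
            rw [pow_succ]
            ring
          rw [hadd])
      rw [h1, Real.sqrt_eq_rpow, ← Real.rpow_mul hμ]
      have hmul : (1 / 2 ^ k * (1 / 2) : ℝ) = 1 / 2 ^ (k + 1) := by
        rw [pow_succ]
        ring
      rw [hmul]
  induction m, hm using Nat.le_induction with
  | base => simpa using hroot
  | succ m hm ih =>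
    have hm' : (0 : ℝ) < m := by exact_mod_cast hm
    have h1 : ((m + 1 : ℕ) / 2 ^ k : ℝ) = m / 2 ^ k + 1 / 2 ^ k := by push_cast; ring
    rw [h1, add_mul, hPsg _ _ (by positivity) (by positivity), ContinuousLinearMap.comp_apply,
      hroot, map_smul, ih, smul_smul, ← Complex.ofReal_mul, mul_comm,
      Real.rpow_add_of_nonneg hμ (by positivity) (by positivity)]

theorem exists_dyadic_btwn {α γ : ℝ} (hα : 0 ≤ α) (hαγ : α < γ) (hγ : γ ≤ 1) :
    ∃ k m : ℕ, 0 < m ∧ m < 2 ^ k ∧ α < (m / 2 ^ k : ℝ) ∧ (m / 2 ^ k : ℝ) < γ := by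
  obtain ⟨k, hk⟩ := exists_pow_lt_of_lt_one (sub_pos.2 hαγ) (by norm_num : (1 / 2 : ℝ) < 1)
  have h2 : (0 : ℝ) < 2 ^ k := by positivity
  have hk' : 1 < (γ - α) * 2 ^ k := by
    rw [one_div, inv_pow] at hk
    rwa [inv_lt_iff_one_lt_mul₀ h2] at hk
  have hlt : ((⌊α * 2 ^ k⌋₊ + 1 : ℕ) : ℝ) < γ * 2 ^ k := by
    have := Nat.floor_le (mul_nonneg hα h2.le)
    push_cast
    nlinarith
  refine ⟨k, ⌊α * 2 ^ k⌋₊ + 1, Nat.succ_pos _, ?_, ?_, ?_⟩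
  · have : ((⌊α * 2 ^ k⌋₊ + 1 : ℕ) : ℝ) < ((2 ^ k : ℕ) : ℝ) := by
      push_cast at hlt ⊢
      nlinarith
    exact_mod_cast this
  · rw [lt_div_iff₀ h2]
    push_cast
    exact Nat.lt_floor_add_one _
  · rwa [div_lt_iff₀ h2]

theorem LinearPMap.IsClosed.exists_norm_apply_le {A : H →ₗ.[ℂ] H} (hA : A.IsClosed)
    (Q : H →L[ℂ] H) (hQ : ∀ x, Q x ∈ A.domain) :
    ∃ M : ℝ, 0 ≤ M ∧ ∀ x, ‖A ⟨Q x, hQ x⟩‖ ≤ M * ‖x‖ := by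
  let g : H →ₗ[ℂ] H := A.toFun ∘ₗ (Q : H →ₗ[ℂ] H).codRestrict A.domain hQ
  have hgraph : ∀ x, (Q x, g x) ∈ A.graph := fun x =>
    (LinearPMap.mem_graph_iff A).2 ⟨⟨Q x, hQ x⟩, rfl, rfl⟩
  let G : H →L[ℂ] H := ContinuousLinearMap.ofSeqClosedGraph (g := g) fun u x y hu hy => by
    have h1 : (Q x, y) ∈ A.graph :=
      (show _root_.IsClosed (A.graph : Set (H × H)) from hA).mem_of_tendsto
        (((Q.continuous.tendsto x).comp hu).prodMk_nhds hy)
        (Filter.Eventually.of_forall fun n => hgraph (u n))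
    exact A.graph_fst_eq_zero_snd (x := Q x - Q x) (x' := y - g x)
      (A.graph.sub_mem h1 (hgraph x)) (sub_self _) |> sub_eq_zero.1
  exact ⟨‖G‖, norm_nonneg _, G.le_opNorm⟩

theorem norm_sesquilinear_le_of_quadratic {D : Submodule ℂ H} {X : D → D → ℂ}
    (hlin : ∀ φ, IsLinearMap ℂ (X φ))
    (hsymm : ∀ φ ψ : D, X φ ψ = starRingEnd ℂ (X ψ φ)) (A : D →ₗ[ℂ] H) {q : ℝ} (hq : 0 ≤ q)
    (hbound : ∀ ψ : D, ‖X ψ ψ‖ ≤ q * ‖A ψ‖ ^ 2) (φ ψ : D) :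
    ‖X φ ψ‖ ≤ q * (‖A φ‖ + ‖A ψ‖) ^ 2 := by
  have hadd : ∀ x y z : D, X (x + y) z = X x z + X y z := fun x y z => by
    rw [hsymm, (hlin z).map_add, map_add, ← hsymm, ← hsymm]
  have hsmul : ∀ (c : ℂ) (x z : D), X (c • x) z = starRingEnd ℂ c * X x z := fun c x z => by
    rw [hsymm, (hlin z).map_smul, smul_eq_mul, map_mul, ← hsymm]
  have hpt : ∀ c : ℂ, ‖c‖ = 1 →
      ‖X (φ + c • ψ) (φ + c • ψ)‖ ≤ q * (‖A φ‖ + ‖A ψ‖) ^ 2 := fun c hc => by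
    refine (hbound _).trans ?_
    gcongr
    rw [map_add, map_smul]
    refine (norm_add_le _ _).trans ?_
    rw [norm_smul, hc, one_mul]
  have hexp : ∀ c : ℂ, X (φ + c • ψ) (φ + c • ψ) = X φ φ + c * X φ ψ +
      starRingEnd ℂ c * X ψ φ + starRingEnd ℂ c * c * X ψ ψ := fun c => by
    rw [hadd, hsmul, (hlin φ).map_add, (hlin ψ).map_add, (hlin φ).map_smul, (hlin ψ).map_smul]
    simp only [smul_eq_mul]
    ring
  have hpol : 4 * X φ ψ = X (φ + (1 : ℂ) • ψ) (φ + (1 : ℂ) • ψ)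
      - X (φ + (-1 : ℂ) • ψ) (φ + (-1 : ℂ) • ψ)
      - I * X (φ + I • ψ) (φ + I • ψ) + I * X (φ + (-I) • ψ) (φ + (-I) • ψ) := by
    simp only [hexp, map_neg, map_one, Complex.conj_I]
    linear_combination (2 * X φ ψ - 2 * X ψ φ) * Complex.I_sq
  have h4 : 4 * ‖X φ ψ‖ ≤ 4 * (q * (‖A φ‖ + ‖A ψ‖) ^ 2) := by
    calc 4 * ‖X φ ψ‖ = ‖4 * X φ ψ‖ := by simp
      _ ≤ ‖X (φ + (1 : ℂ) • ψ) (φ + (1 : ℂ) • ψ)‖ + ‖X (φ + (-1 : ℂ) • ψ) (φ + (-1 : ℂ) • ψ)‖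
          + ‖I * X (φ + I • ψ) (φ + I • ψ)‖ + ‖I * X (φ + (-I) • ψ) (φ + (-I) • ψ)‖ := by
        rw [hpol]
        refine (norm_add_le _ _).trans (add_le_add_left ((norm_sub_le _ _).trans
          (add_le_add_left (norm_sub_le _ _) _)) _)
      _ ≤ 4 * (q * (‖A φ‖ + ‖A ψ‖) ^ 2) := by
        rw [norm_mul, norm_mul, Complex.norm_I, one_mul, one_mul]
        linarith [hpt 1 (by simp), hpt (-1) (by simp), hpt I (by simp), hpt (-I) (by simp)]
  linarith

theorem exists_clm_of_form_bounded {A : H →ₗ.[ℂ] H} (hA : A.IsClosed)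
    {X : A.domain → A.domain → ℂ} (hlin : ∀ φ, IsLinearMap ℂ (X φ))
    (hsymm : ∀ φ ψ : A.domain, X φ ψ = starRingEnd ℂ (X ψ φ)) {q : ℝ} (hq : 0 ≤ q)
    (hbound : ∀ ψ : A.domain, ‖X ψ ψ‖ ≤ q * ‖A ψ‖ ^ 2)
    (Q R : H →L[ℂ] H) (hQ : ∀ x, Q x ∈ A.domain) (hR : ∀ x, R x ∈ A.domain) :
    ∃ B : H →L[ℂ] H, ∀ x y, (⟪x, B y⟫_ℂ : ℂ) = X ⟨Q x, hQ x⟩ ⟨R y, hR y⟩ := by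
  let Q' : H →ₗ[ℂ] A.domain := (Q : H →ₗ[ℂ] H).codRestrict A.domain hQ
  let R' : H →ₗ[ℂ] A.domain := (R : H →ₗ[ℂ] H).codRestrict A.domain hR
  have hadd : ∀ x y z : A.domain, X (x + y) z = X x z + X y z := fun x y z => by
    rw [hsymm, (hlin z).map_add, map_add, ← hsymm, ← hsymm]
  have hsmul : ∀ (c : ℂ) (x z : A.domain), X (c • x) z = starRingEnd ℂ c * X x z :=
    fun c x z => by rw [hsymm, (hlin z).map_smul, smul_eq_mul, map_mul, ← hsymm]
  let F : H →ₗ⋆[ℂ] H →ₗ[ℂ] ℂ := LinearMap.mk₂'ₛₗ (starRingEnd ℂ) (RingHom.id ℂ)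
    (fun x y => X (Q' x) (R' y))
    (fun x x' y => by simp only [map_add, hadd])
    (fun c x y => by simp only [map_smul, hsmul, smul_eq_mul])
    (fun x y y' => by simp only [map_add, (hlin _).map_add])
    (fun c x y => by simp only [map_smul, (hlin _).map_smul, RingHom.id_apply])
  obtain ⟨M, hM0, hM⟩ := hA.exists_norm_apply_le Q hQ
  obtain ⟨N, hN0, hN⟩ := hA.exists_norm_apply_le R hR
  have hF1 : ∀ x y, ‖x‖ = 1 → ‖y‖ = 1 → ‖F x y‖ ≤ q * (M + N) ^ 2 := fun x y hx hy => by
    refine (norm_sesquilinear_le_of_quadratic hlin hsymm A.toFun hq hbound (Q' x) (R' y)).trans ?_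
    gcongr
    · exact (hM x).trans_eq (by rw [hx, mul_one])
    · exact (hN y).trans_eq (by rw [hy, mul_one])
  have hF : ∀ x y, ‖F x y‖ ≤ q * (M + N) ^ 2 * ‖x‖ * ‖y‖ := fun x y => by
    rcases eq_or_ne x 0 with rfl | hx
    · simp
    rcases eq_or_ne y 0 with rfl | hy
    · simp
    have hx' : ‖x‖ ≠ 0 := norm_ne_zero_iff.2 hx
    have hy' : ‖y‖ ≠ 0 := norm_ne_zero_iff.2 hy
    have h := hF1 (((‖x‖⁻¹ : ℝ) : ℂ) • x) (((‖y‖⁻¹ : ℝ) : ℂ) • y)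
      (by rw [norm_smul, Complex.norm_real, norm_inv, norm_norm, inv_mul_cancel₀ hx'])
      (by rw [norm_smul, Complex.norm_real, norm_inv, norm_norm, inv_mul_cancel₀ hy'])
    simp only [LinearMap.map_smulₛₗ, LinearMap.smul_apply, RingHom.id_apply, norm_smul,
      Complex.conj_ofReal, Complex.norm_real, norm_inv, norm_norm] at h
    have h2 : 0 < ‖x‖ * ‖y‖ := by positivity
    calc ‖F x y‖ = (‖y‖⁻¹ * (‖x‖⁻¹ * ‖F x y‖)) * (‖x‖ * ‖y‖) := by field_simp
      _ ≤ q * (M + N) ^ 2 * (‖x‖ * ‖y‖) := by gcongr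
      _ = _ := by ring
  let L : H →L⋆[ℂ] H →L[ℂ] ℂ := F.mkContinuous₂ (q * (M + N) ^ 2) hF
  refine ⟨(InnerProductSpace.continuousLinearMapOfBilin L).adjoint, fun x y => ?_⟩
  rw [ContinuousLinearMap.adjoint_inner_right,
    InnerProductSpace.continuousLinearMapOfBilin_apply]
  rfl

theorem IsTraceClassPos.exists_sum_le_s14 {T : H →L[ℂ] H} (hT : IsTraceClassPos T) :
    ∃ C : ℝ, ∀ (κ : Type) (f : HilbertBasis κ ℂ H) (s : Finset κ),
      ∑ i ∈ s, ((⟪f i, T (f i)⟫_ℂ : ℂ)).re ≤ C := by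
  obtain ⟨C, hC⟩ := hT
  refine ⟨C, fun κ f s => ?_⟩
  have hinj : Function.Injective f := f.orthonormal.linearIndependent.injective
  have := hC (s.map ⟨f, hinj⟩) ?_ ?_
  · simpa using this
  · intro v hv
    obtain ⟨i, -, rfl⟩ := Finset.mem_map.1 hv
    exact f.orthonormal.1 i
  · intro v hv w hw hvw
    obtain ⟨i, -, rfl⟩ := Finset.mem_map.1 hv
    obtain ⟨j, -, rfl⟩ := Finset.mem_map.1 hw
    exact f.orthonormal.2 fun h => hvw (by rw [h])

theorem IsTraceClassPos.exists_summable_eigenbasis {ι : Type} (e : HilbertBasis ι ℂ H)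
    {T Q : H →L[ℂ] H} (hT : IsTraceClassPos T) (hpos : T.IsPositive) (hQ : IsSelfAdjoint Q)
    (hTQ : T = Q.comp Q) :
    ∃ (κ : Type) (f : HilbertBasis κ ℂ H) (μ : κ → ℝ), (∀ j, 0 ≤ μ j) ∧ Summable μ ∧
      ∀ j, T (f j) = (μ j : ℂ) • f j := by
  obtain ⟨C, hC⟩ := hT.exists_sum_le_s14
  have hQc : IsCompactOperator Q := by
    refine e.isCompactOperator_of_sum_le hQ (C := C) fun s => ?_
    refine le_of_eq_of_le (Finset.sum_congr rfl fun i _ => ?_) (hC ι e s)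
    rw [hTQ, ContinuousLinearMap.comp_apply, ← ContinuousLinearMap.adjoint_inner_left,
      hQ.adjoint_eq]
    exact (inner_self_eq_norm_sq (𝕜 := ℂ) _).symm
  have hTc : IsCompactOperator T := by
    rw [hTQ]
    exact hQc.comp_clm Q
  obtain ⟨κ, f, μ, hμ0, hμ⟩ := hTc.exists_eigenbasis hpos
  refine ⟨κ, f, μ, hμ0, summable_of_sum_le hμ0 (c := C) fun s => ?_, hμ⟩
  refine le_of_eq_of_le (Finset.sum_congr rfl fun i _ => ?_) (hC κ f s)
  rw [hμ, inner_smul_right, inner_self_eq_norm_sq_to_K, f.orthonormal.1]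
  simp

theorem exists_clm_hasCyclicTrace {ι : Type} (e : HilbertBasis ι ℂ H)
    {A : H →ₗ.[ℂ] H} (hA : A.IsClosed)
    {X : A.domain → A.domain → ℂ} (hlin : ∀ φ, IsLinearMap ℂ (X φ))
    (hsymm : ∀ φ ψ : A.domain, X φ ψ = starRingEnd ℂ (X ψ φ)) {q : ℝ} (hq : 0 ≤ q)
    (hbound : ∀ ψ : A.domain, ‖X ψ ψ‖ ≤ q * ‖A ψ‖ ^ 2)
    {P : ℝ → H →L[ℂ] H}
    (hPsg : ∀ s t : ℝ, 0 < s → 0 < t → P (s + t) = (P s).comp (P t))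
    (hPpos : ∀ s : ℝ, 0 < s → (P s).IsPositive)
    (hPdom : ∀ s : ℝ, 0 < s → ∀ x : H, P s x ∈ A.domain)
    {β : ℝ} (hβ : 0 < β) (htr : IsTraceClassPos (P β)) {s t : ℝ} (hs : 0 < s) (ht : 0 < t)
    (hst : β < s + t) :
    ∃ S : H →L[ℂ] H, HasCyclicTrace e S ∧
      ∀ x y, (⟪x, S y⟫_ℂ : ℂ) = X ⟨P s x, hPdom s hs x⟩ ⟨P t y, hPdom t ht y⟩ := by
  have hβ2 : 0 < β / 2 := by linarith
  obtain ⟨κ, f, μ, hμ0, hμs, hμ⟩ := htr.exists_summable_eigenbasis e (hPpos β hβ)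
    (hPpos _ hβ2).isSelfAdjoint (by rw [← hPsg _ _ hβ2 hβ2, add_halves])
  obtain ⟨k, m, hm0, hmk, h1, h2⟩ := exists_dyadic_btwn (α := max 0 (1 - t / β))
    (γ := min 1 (s / β)) (le_max_left _ _) (by
      rw [max_lt_iff, lt_min_iff, lt_min_iff]
      have : 1 < s / β + t / β := by rw [← add_div, lt_div_iff₀ hβ]; linarith
      have h3 : 0 < s / β := by positivity
      have h4 : 0 < t / β := by positivity
      exact ⟨⟨one_pos, h3⟩, by linarith, by linarith⟩) (min_le_left _ _)
  rw [max_lt_iff] at h1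
  rw [lt_min_iff] at h2
  set θ : ℝ := m / 2 ^ k with hθ
  have hθs : θ * β < s := (lt_div_iff₀ hβ).1 h2.2
  have hθt : (1 - θ) * β < t := by
    have : 1 - θ < t / β := by linarith [h1.2]
    exact (lt_div_iff₀ hβ).1 this
  have hθ0 : 0 < θ * β := mul_pos h1.1 hβ
  have hθ1 : 0 < (1 - θ) * β := mul_pos (by linarith [h2.1]) hβ
  have hf1 : ∀ i, P (θ * β) (f i) = ((μ i ^ θ : ℝ) : ℂ) • f i := fun i =>
    apply_dyadic_eq_rpow_smul hPsg hPpos hβ (hμ0 i) (hμ i) k hm0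
  have hf2 : ∀ i, P ((1 - θ) * β) (f i) = ((μ i ^ (1 - θ) : ℝ) : ℂ) • f i := fun i => by
    have := apply_dyadic_eq_rpow_smul hPsg hPpos hβ (hμ0 i) (hμ i) k (Nat.sub_pos_of_lt hmk)
    have h3 : (((2 ^ k - m : ℕ) : ℝ) / 2 ^ k) = 1 - θ := by
      rw [Nat.cast_sub hmk.le, hθ, sub_div]
      push_cast
      rw [div_self (by positivity)]
    rwa [h3] at this
  have hs' : 0 < s - θ * β := sub_pos.2 hθs
  have ht' : 0 < t - (1 - θ) * β := sub_pos.2 hθt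
  obtain ⟨S, hS⟩ := exists_clm_of_form_bounded hA hlin hsymm hq hbound (P s) (P t)
    (hPdom s hs) (hPdom t ht)
  obtain ⟨B, hB⟩ := exists_clm_of_form_bounded hA hlin hsymm hq hbound (P (s - θ * β))
    (P (t - (1 - θ) * β)) (hPdom _ hs') (hPdom _ ht')
  refine ⟨S, HasCyclicTrace.of_weights e f hμ0 hμs h1.1 h2.1 B S fun i j => ?_, hS⟩
  have h5 : P s (f i) = P (s - θ * β) (((μ i ^ θ : ℝ) : ℂ) • f i) := by
    rw [← hf1, ← ContinuousLinearMap.comp_apply, ← hPsg _ _ hs' hθ0, sub_add_cancel]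
  have h6 : P t (f j) = P (t - (1 - θ) * β) (((μ j ^ (1 - θ) : ℝ) : ℂ) • f j) := by
    rw [← hf2, ← ContinuousLinearMap.comp_apply, ← hPsg _ _ ht' hθ1, sub_add_cancel]
  calc (⟪f i, S (f j)⟫_ℂ : ℂ)
      = ⟪((μ i ^ θ : ℝ) : ℂ) • f i, B (((μ j ^ (1 - θ) : ℝ) : ℂ) • f j)⟫_ℂ := by
        rw [hS, hB]
        exact congrArg₂ X (Subtype.ext h5) (Subtype.ext h6)
    _ = _ := by
        rw [map_smul, inner_smul_left, inner_smul_right, Complex.conj_ofReal, Complex.ofReal_mul,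
          mul_assoc]

/-- Let `ρ₀ ∈ C_{β₀} ∩ Σ`, `β₀ < 1`, with fractional powers `P l = ρ₀^l` mapping `H`
into the form domain `Q₀ = D(A)`, `A = H₀^{1/2}`, and let `X` be a `q₀`-bounded symmetric
form.  The regularized mean `ρ₀·X = Tr(ρ₀^l X ρ₀^{1-l}) = ∑ᵢ X(ρ₀^l eᵢ, ρ₀^{1-l} eᵢ)`
is finite and independent of `l ∈ (0,1)`. -/
theorem regularized_mean_finite_and_lambda_independent {ι : Type} (e : HilbertBasis ι ℂ H)
    (A : H →ₗ.[ℂ] H) (hdense : Dense (A.domain : Set H)) (hsaA : IsSelfAdjoint A)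
    (hge : ∀ ψ : A.domain, ‖(ψ : H)‖ ≤ ‖A ψ‖)
    (X : A.domain → A.domain → ℂ)
    (hlin : ∀ φ, IsLinearMap ℂ (X φ))
    (hsymm : ∀ φ ψ : A.domain, X φ ψ = starRingEnd ℂ (X ψ φ))
    (a b : ℝ) (ha0 : 0 ≤ a) (hb : 0 ≤ b)
    (hbound : ∀ ψ : A.domain, ‖X ψ ψ‖ ≤ a * ‖A ψ‖ ^ 2 + b * ‖(ψ : H)‖ ^ 2)
    -- the fractional powers `P l = ρ₀^l` of the density operator `ρ₀ = P 1`
    (P : ℝ → H →L[ℂ] H)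
    (hPsg : ∀ s t : ℝ, 0 < s → 0 < t → P (s + t) = (P s).comp (P t))
    (hPsa : ∀ s : ℝ, 0 < s → IsSelfAdjoint (P s))
    (hPpos : ∀ s : ℝ, 0 < s → (P s).IsPositive)
    (hPdom : ∀ s : ℝ, 0 < s → ∀ x : H, P s x ∈ A.domain)  -- `ρ₀^l` maps `H` into `Q₀`
    (β₀ : ℝ) (hβ0 : 0 < β₀) (hβ1 : β₀ < 1)
    (htrβ : IsTraceClassPos (P β₀))  -- `ρ₀ ∈ C_{β₀}`
    (hdensity : HasSum (fun i => ((⟪e i, P 1 (e i)⟫_ℂ : ℂ)).re) 1)  -- `Tr ρ₀ = 1`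
    : ∀ l : ℝ, ∀ hl : l ∈ Set.Ioo (0 : ℝ) 1,
      Summable (fun i => X ⟨P l (e i), hPdom l hl.1 (e i)⟩
        ⟨P (1 - l) (e i), hPdom (1 - l) (by linarith [hl.2]) (e i)⟩) ∧
      ∀ m : ℝ, ∀ hm : m ∈ Set.Ioo (0 : ℝ) 1,
        (∑' i, X ⟨P l (e i), hPdom l hl.1 (e i)⟩
            ⟨P (1 - l) (e i), hPdom (1 - l) (by linarith [hl.2]) (e i)⟩) =
        (∑' i, X ⟨P m (e i), hPdom m hm.1 (e i)⟩
            ⟨P (1 - m) (e i), hPdom (1 - m) (by linarith [hm.2]) (e i)⟩) := by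
  have hA : A.IsClosed := hsaA.isClosed
  have hq : ∀ ψ : A.domain, ‖X ψ ψ‖ ≤ (a + b) * ‖A ψ‖ ^ 2 := fun ψ => by
    refine (hbound ψ).trans ?_
    rw [add_mul]
    gcongr
    exact hge ψ
  let g : Set.Ioo (0 : ℝ) 1 → ι → ℂ := fun l i => X ⟨P l (e i), hPdom l l.2.1 (e i)⟩
    ⟨P (1 - l) (e i), hPdom (1 - l) (by linarith [l.2.2]) (e i)⟩
  have hsum : ∀ l, Summable (g l) := fun l => by
    obtain ⟨S, hS, hSX⟩ := exists_clm_hasCyclicTrace e hA hlin hsymm (add_nonneg ha0 hb) hq hPsg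
      hPpos hPdom hβ0 htrβ l.2.1 (sub_pos.2 l.2.2) (by linarith)
    obtain ⟨c, hc, -⟩ := hS (ContinuousLinearMap.id ℂ H)
    simp only [ContinuousLinearMap.id_apply, hSX] at hc
    exact hc.summable
  have hstep : ∀ l m : Set.Ioo (0 : ℝ) 1, (l : ℝ) < m → (m : ℝ) - l < 1 - β₀ →
      ∑' i, g l i = ∑' i, g m i := fun l m hlm hd => by
    have hml : 0 < (m : ℝ) - l := sub_pos.2 hlm
    have hm1 : 0 < 1 - (m : ℝ) := sub_pos.2 m.2.2
    obtain ⟨S, hS, hSX⟩ := exists_clm_hasCyclicTrace e hA hlin hsymm (add_nonneg ha0 hb) hq hPsg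
      hPpos hPdom hβ0 htrβ l.2.1 hm1 (by linarith)
    obtain ⟨c, hc1, hc2⟩ := hS (P (m - l))
    have h1 : HasSum (g m) c := by
      convert hc1 using 1
      funext i
      rw [← ContinuousLinearMap.adjoint_inner_left, (hPsa _ hml).adjoint_eq, hSX]
      refine congrArg₂ X (Subtype.ext ?_) rfl
      change P m (e i) = P l (P (m - l) (e i))
      rw [← ContinuousLinearMap.comp_apply, ← hPsg _ _ l.2.1 hml, add_sub_cancel]
    have h2 : HasSum (g l) c := by
      convert hc2 using 1
      funext i
      rw [hSX]
      refine congrArg₂ X rfl (Subtype.ext ?_)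
      change P (1 - l) (e i) = P (1 - m) (P (m - l) (e i))
      rw [← ContinuousLinearMap.comp_apply, ← hPsg _ _ hm1 hml, sub_add_sub_cancel]
    rw [h1.tsum_eq, h2.tsum_eq]
  have hchain : ∀ n : ℕ, ∀ l m : Set.Ioo (0 : ℝ) 1, (l : ℝ) < m →
      (m : ℝ) - l < 2 ^ n * (1 - β₀) → ∑' i, g l i = ∑' i, g m i := by
    intro n
    induction n with
    | zero => simpa using hstep
    | succ n ih =>
      intro l m hlm hd
      rw [pow_succ] at hd
      have h1 := l.2.1
      have h2 := m.2.2
      exact (ih l ⟨((l : ℝ) + m) / 2, by linarith, by linarith⟩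
        (show (l : ℝ) < (l + m) / 2 by linarith)
        (show ((l : ℝ) + m) / 2 - l < _ by linarith)).trans
        (ih _ m (show ((l : ℝ) + m) / 2 < m by linarith)
          (show (m : ℝ) - (l + m) / 2 < _ by linarith))
  obtain ⟨n, hn⟩ := pow_unbounded_of_one_lt (1 / (1 - β₀)) (one_lt_two : (1 : ℝ) < 2)
  rw [div_lt_iff₀ (sub_pos.2 hβ1)] at hn
  have hlt : ∀ l m : Set.Ioo (0 : ℝ) 1, (l : ℝ) < m → ∑' i, g l i = ∑' i, g m i :=
    fun l m hlm => hchain n l m hlm (by linarith [l.2.1, m.2.2])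
  intro l hl
  refine ⟨hsum ⟨l, hl⟩, fun m hm => ?_⟩
  rcases lt_trichotomy l m with h | h | h
  · exact hlt ⟨l, hl⟩ ⟨m, hm⟩ h
  · subst h
    rfl
  · exact (hlt ⟨m, hm⟩ ⟨l, hl⟩ h).symm
end
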